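/- Inversion lies in the field F: suppose the meromorphic mapping Φ = (φ₁,…,φ_n) admits an algebraic addition theorem and let θ be a primitive element as described. Then for every k ∈ {1,…,n} the function u ↦ φ_k(−u) is a rational function of θ(u), φ₁(u),…,φ_n(u): there exist polynomials A, B ∈ ℂ[t, x₁,…,x_n] with B(θ(u); φ₁(u),…,φ_n(u)) not identically zero, such that φ_k(−u) = A(θ(u); φ₁(u),…,φ_n(u)) / B(θ(u); φ₁(u),…,φ_n(u)) for every u at which all the functions involved are analytic and the denominator is nonzero. -/

import Mathlib

open MvPolynomial

/-- The partial derivative `∂f/∂u_p` of a function on ℂⁿ. -/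
noncomputable def pd {n : ℕ} (f : (Fin n → ℂ) → ℂ) (p : Fin n) (u : Fin n → ℂ) : ℂ :=
  fderiv ℂ f u (Pi.single p 1)

/-- `f` is meromorphic on ℂⁿ: a quotient of two everywhere-analytic functions. -/
def Mero {n : ℕ} (f : (Fin n → ℂ) → ℂ) : Prop :=
  ∃ g h : (Fin n → ℂ) → ℂ, (∀ u, AnalyticAt ℂ g u) ∧ (∀ u, AnalyticAt ℂ h u) ∧
    (∃ u, h u ≠ 0) ∧ ∀ u, h u ≠ 0 → f u = g u / h u

/-- The Jacobian determinant of the family `φ` is not identically zero. -/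
def AnalyticallyIndep {n : ℕ} (φ : Fin n → (Fin n → ℂ) → ℂ) : Prop :=
  ∃ u : Fin n → ℂ, (∀ j, AnalyticAt ℂ (φ j) u) ∧
    Matrix.det (Matrix.of fun k p => pd (φ k) p u) ≠ 0

/-- `Φ = (φ₁,…,φ_n)` admits an algebraic addition theorem: for each `k` there is a
polynomial `G_k` in the variables `λ` (= `none`), `x_j` (= `some (inl j)`) and
`y_j` (= `some (inr j)`), of degree ≥ 1 in `λ`, with
`G_k(φ_k(u+v); φ(u), φ(v)) = 0` wherever all functions involved are analytic. -/
def AdmitsAAT {n : ℕ} (φ : Fin n → (Fin n → ℂ) → ℂ) : Prop :=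
  ∀ k : Fin n, ∃ G : MvPolynomial (Option (Fin n ⊕ Fin n)) ℂ,
    1 ≤ G.degreeOf none ∧
    ∀ u v : Fin n → ℂ, (∀ j, AnalyticAt ℂ (φ j) u) → (∀ j, AnalyticAt ℂ (φ j) v) →
      AnalyticAt ℂ (φ k) (u + v) →
      eval (fun i => i.elim (φ k (u + v)) (Sum.elim (fun j => φ j u) fun j => φ j v)) G = 0

/-- The valuation sending the variable `none` to `θ(u)` and `some j` to `φ_j(u)`. -/
noncomputable def tval {n : ℕ} (θ : (Fin n → ℂ) → ℂ) (φ : Fin n → (Fin n → ℂ) → ℂ)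
    (u : Fin n → ℂ) : Option (Fin n) → ℂ :=
  fun i => i.elim (θ u) fun j => φ j u

/-- `f` is a rational function on ℂⁿ. -/
def RatFn {n : ℕ} (f : (Fin n → ℂ) → ℂ) : Prop :=
  ∃ P Q : MvPolynomial (Fin n) ℂ, Q ≠ 0 ∧
    ∃ s : Set (Fin n → ℂ), IsOpen s ∧ s.Nonempty ∧
      ∀ u ∈ s, f u = eval u P / eval u Q

section AuxDevelopment
open Filter Topology

section basics
variable {E : Type*} [NormedAddCommGroup E] [NormedSpace ℂ E]

lemma ana_freq {f : E → ℂ} {S : Set E} (hf : AnalyticOnNhd ℂ f S) (hS : IsPreconnected S)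
    (h : ∃ u ∈ S, f u ≠ 0) {v : E} (hv : v ∈ S) : ∃ᶠ z in 𝓝 v, f z ≠ 0 := by
  obtain ⟨u, hu, hne⟩ := h
  intro hcon
  have : f =ᶠ[𝓝 v] 0 := by
    filter_upwards [hcon] with z hz
    simpa using hz
  exact hne (hf.eqOn_zero_of_preconnected_of_eventuallyEq_zero hS hv this hu)

lemma ana_mul {f g : E → ℂ} {S : Set E} (hf : AnalyticOnNhd ℂ f S) (hg : AnalyticOnNhd ℂ g S)
    (hS : IsPreconnected S) (hSo : IsOpen S)
    (h1 : ∃ u ∈ S, f u ≠ 0) (h2 : ∃ u ∈ S, g u ≠ 0) : ∃ u ∈ S, f u ≠ 0 ∧ g u ≠ 0 := by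
  obtain ⟨v, hv, hfv⟩ := h1
  have h3 := (hf v hv).continuousAt.eventually_ne hfv
  have h4 := (ana_freq hg hS h2 hv).and_eventually (h3.and (hSo.mem_nhds hv))
  obtain ⟨z, hz⟩ := h4.exists
  exact ⟨z, hz.2.2, hz.2.1, hz.1⟩

lemma ent_freq {f : E → ℂ} (hf : ∀ u, AnalyticAt ℂ f u) 
    (h : ∃ u, f u ≠ 0) (v : E) : ∃ᶠ z in 𝓝 v, f z ≠ 0 :=
  ana_freq (S := Set.univ) (fun u _ => hf u) isPreconnected_univ (by simpa using h) trivial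

lemma ent_mul {f g : E → ℂ} (hf : ∀ u, AnalyticAt ℂ f u) (hg : ∀ u, AnalyticAt ℂ g u)
    (h1 : ∃ u, f u ≠ 0) (h2 : ∃ u, g u ≠ 0) : ∃ u, f u * g u ≠ 0 := by
  obtain ⟨u, -, h⟩ := ana_mul (S := Set.univ) (fun u _ => hf u) (fun u _ => hg u)
    isPreconnected_univ isOpen_univ (by simpa using h1) (by simpa using h2)
  exact ⟨u, mul_ne_zero h.1 h.2⟩

lemma ent_prod {ι : Type*} (s : Finset ι) (f : ι → E → ℂ) (hf : ∀ i ∈ s, ∀ u, AnalyticAt ℂ (f i) u)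
    (h1 : ∀ i ∈ s, ∃ u, f i u ≠ 0) : ∃ u, ∏ i ∈ s, f i u ≠ 0 := by
  classical
  induction s using Finset.induction_on with
  | empty => exact ⟨0, by simp⟩
  | insert a s ha ih =>
    have := ent_mul (f := f a) (g := fun u => ∏ i ∈ s, f i u) (hf a (by simp))
      (fun u => Finset.analyticAt_fun_prod _ (fun i hi => hf i (by simp [hi]) u)) (h1 a (by simp))
      (ih (fun i hi => hf i (by simp [hi])) (fun i hi => h1 i (by simp [hi])))
    simpa [Finset.prod_insert ha] using this

lemma ent_eq {f g : E → ℂ} (hf : ∀ u, AnalyticAt ℂ f u) (hg : ∀ u, AnalyticAt ℂ g u) {w : E}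
    (h : f =ᶠ[𝓝 w] g) : f = g :=
  AnalyticOnNhd.eq_of_eventuallyEq (fun u _ => hf u) (fun u _ => hg u) h
end basics

section mero
variable {n : ℕ}

/-- `m` good function. -/
lemma analyticAt_mvpoly {E : Type*} [NormedAddCommGroup E] [NormedSpace ℂ E] {σ : Type*}
    (P : MvPolynomial σ ℂ) (F : σ → E → ℂ) (u : E) (hF : ∀ i, AnalyticAt ℂ (F i) u) :
    AnalyticAt ℂ (fun z => eval (fun i => F i z) P) u := by
  induction P using MvPolynomial.induction_on with
  | C a => simpa using analyticAt_const
  | add p q hp hq =>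
    simp only [map_add]
    exact hp.fun_add hq
  | mul_X p i hp =>
    simp only [map_mul, eval_X]
    exact hp.fun_mul (hF i)

lemma coord_ana (i : Fin n) (u : Fin n → ℂ) : AnalyticAt ℂ (fun z : Fin n → ℂ => z i) u :=
  ContinuousLinearMap.analyticAt (ContinuousLinearMap.proj (R := ℂ) (φ := fun _ : Fin n => ℂ) i) u

lemma mvpoly_ent (P : MvPolynomial (Fin n) ℂ) (u : Fin n → ℂ) :
    AnalyticAt ℂ (fun z : Fin n → ℂ => eval z P) u := by
  have := analyticAt_mvpoly P (fun i (z : Fin n → ℂ) => z i) u (fun i => coord_ana i u)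
  exact this

lemma Mero.const (c : ℂ) : Mero (fun _ : Fin n → ℂ => c) :=
  ⟨fun _ => c, fun _ => 1, fun _ => analyticAt_const, fun _ => analyticAt_const, ⟨0, by simp⟩,
    by simp⟩

lemma Mero.add {f g : (Fin n → ℂ) → ℂ} (hf : Mero f) (hg : Mero g) : Mero (fun u => f u + g u) := by
  obtain ⟨a, b, ha, hb, hb0, h⟩ := hf
  obtain ⟨a', b', ha', hb', hb0', h'⟩ := hg
  refine ⟨fun u => a u * b' u + a' u * b u, fun u => b u * b' u,
    fun u => ((ha u).mul (hb' u)).add ((ha' u).mul (hb u)), fun u => (hb u).mul (hb' u),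
    ent_mul hb hb' hb0 hb0', fun u hu => ?_⟩
  have h1 := left_ne_zero_of_mul hu
  have h2 := right_ne_zero_of_mul hu
  beta_reduce
  rw [h u h1, h' u h2]
  field_simp

lemma Mero.mul {f g : (Fin n → ℂ) → ℂ} (hf : Mero f) (hg : Mero g) : Mero (fun u => f u * g u) := by
  obtain ⟨a, b, ha, hb, hb0, h⟩ := hf
  obtain ⟨a', b', ha', hb', hb0', h'⟩ := hg
  refine ⟨fun u => a u * a' u, fun u => b u * b' u,
    fun u => (ha u).mul (ha' u), fun u => (hb u).mul (hb' u),
    ent_mul hb hb' hb0 hb0', fun u hu => ?_⟩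
  have h1 := left_ne_zero_of_mul hu
  have h2 := right_ne_zero_of_mul hu
  beta_reduce
  rw [h u h1, h' u h2]
  field_simp

lemma Mero.sum {ι : Type*} (s : Finset ι) {f : ι → (Fin n → ℂ) → ℂ} (hf : ∀ i ∈ s, Mero (f i)) :
    Mero (fun u => ∑ i ∈ s, f i u) := by
  classical
  induction s using Finset.induction_on with
  | empty => simpa using Mero.const 0
  | insert a s ha ih =>
    simpa [Finset.sum_insert ha] using
      (hf a (by simp)).add (ih (fun i hi => hf i (by simp [hi])))

lemma Mero.prod {ι : Type*} (s : Finset ι) {f : ι → (Fin n → ℂ) → ℂ} (hf : ∀ i ∈ s, Mero (f i)) :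
    Mero (fun u => ∏ i ∈ s, f i u) := by
  classical
  induction s using Finset.induction_on with
  | empty => simpa using Mero.const 1
  | insert a s ha ih =>
    simpa [Finset.prod_insert ha] using
      (hf a (by simp)).mul (ih (fun i hi => hf i (by simp [hi])))

lemma Mero.mvpoly {σ : Type*} (P : MvPolynomial σ ℂ) {F : σ → (Fin n → ℂ) → ℂ}
    (hF : ∀ i, Mero (F i)) : Mero (fun z => eval (fun i => F i z) P) := by
  induction P using MvPolynomial.induction_on with
  | C a => simpa using Mero.const a
  | add p q hp hq => simpa using hp.add hq
  | mul_X p i hp => simpa using hp.mul (hF i)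

lemma analyticAt_neg_fun (u : Fin n → ℂ) : AnalyticAt ℂ (fun z : Fin n → ℂ => -z) u :=
  analyticAt_id.neg

lemma Mero.comp_neg {f : (Fin n → ℂ) → ℂ} (hf : Mero f) : Mero (fun u => f (-u)) := by
  obtain ⟨a, b, ha, hb, ⟨w, hw⟩, h⟩ := hf
  exact ⟨fun u => a (-u), fun u => b (-u), fun u => (ha (-u)).fun_comp (analyticAt_neg_fun u),
    fun u => (hb (-u)).fun_comp (analyticAt_neg_fun u), ⟨-w, by simpa using hw⟩, fun u hu => h _ hu⟩

lemma pd_analyticAt {f : (Fin n → ℂ) → ℂ} {u} (hf : AnalyticAt ℂ f u) (p : Fin n) :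
    AnalyticAt ℂ (pd f p) u :=
  ((ContinuousLinearMap.apply ℂ ℂ (Pi.single p 1 : Fin n → ℂ)).analyticAt _).fun_comp hf.fderiv

lemma Mero.pd {f : (Fin n → ℂ) → ℂ} (hf : Mero f) (p : Fin n) : Mero (pd f p) := by
  obtain ⟨a, b, ha, hb, hb0, h⟩ := hf
  refine ⟨fun u => _root_.pd a p u * b u - a u * _root_.pd b p u, fun u => b u * b u,
    fun u => ((pd_analyticAt (ha u) p).mul (hb u)).sub ((ha u).mul (pd_analyticAt (hb u) p)),
    fun u => (hb u).mul (hb u), ent_mul hb hb hb0 hb0, fun u hu => ?_⟩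
  have h1 := left_ne_zero_of_mul hu
  have h2 : f =ᶠ[𝓝 u] fun z => a z / b z := by
    filter_upwards [(hb u).continuousAt.eventually_ne h1] with z hz using h z hz
  have h3 : (fun z => f z * b z) =ᶠ[𝓝 u] a := by
    filter_upwards [(hb u).continuousAt.eventually_ne h1] with z hz
    rw [h z hz]; field_simp
  have hfd : DifferentiableAt ℂ f u := by
    have : AnalyticAt ℂ f u := ((ha u).div (hb u) h1).congr h2.symm
    exact this.differentiableAt
  have h4 := h3.fderiv_eq (𝕜 := ℂ)
  rw [fderiv_fun_mul hfd (hb u).differentiableAt] at h4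
  have h5 := congrArg (fun L => L (Pi.single p 1 : Fin n → ℂ)) h4
  simp at h5
  rw [h u h1] at h5
  simp only [_root_.pd]
  rw [← h5]
  field_simp
  ring

lemma Mero.eq_zero {F : (Fin n → ℂ) → ℂ} (hF : Mero F) {w : Fin n → ℂ} (h0 : ∀ᶠ z in 𝓝 w, F z = 0)
    (u : Fin n → ℂ) (hu : ContinuousAt F u) : F u = 0 := by
  obtain ⟨a, b, ha, hb, hb0, h⟩ := hF
  have h1 : (fun z => a z * b z) = fun _ => 0 := by
    refine ent_eq (w := w) (fun u => (ha u).mul (hb u)) (fun u => analyticAt_const) ?_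
    filter_upwards [h0] with z hz
    by_cases hbz : b z = 0
    · simp [hbz]
    · have := h z hbz
      rw [hz, eq_comm, div_eq_zero_iff] at this
      simp [this.resolve_right hbz]
  by_contra hne
  have h2 := hu.eventually_ne hne
  obtain ⟨z, hz1, hz2⟩ := ((ent_freq hb hb0 u).and_eventually h2).exists
  have h3 := congrFun h1 z
  simp only [mul_eq_zero] at h3
  exact hz2 (by rw [h z hz1, h3.resolve_right hz1, zero_div])

/-- Entire nonzero function detecting good points for `F`. -/
lemma Mero.good {F : (Fin n → ℂ) → ℂ} (hF : Mero F) {w : Fin n → ℂ} (hw : ContinuousAt F w)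
    (hne : F w ≠ 0) : ∃ H : (Fin n → ℂ) → ℂ, (∀ u, AnalyticAt ℂ H u) ∧ (∃ u, H u ≠ 0) ∧
      ∀ u, H u ≠ 0 → AnalyticAt ℂ F u ∧ F u ≠ 0 := by
  obtain ⟨a, b, ha, hb, hb0, h⟩ := hF
  have ha0 : ∃ u, a u ≠ 0 := by
    obtain ⟨z, hz1, hz2⟩ := ((ent_freq hb hb0 w).and_eventually (hw.eventually_ne hne)).exists
    refine ⟨z, fun h0 => hz2 (by rw [h z hz1, h0, zero_div])⟩
  refine ⟨fun u => a u * b u, fun u => (ha u).mul (hb u), ent_mul ha hb ha0 hb0, fun u hu => ?_⟩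
  have h1 := left_ne_zero_of_mul hu
  have h2 := right_ne_zero_of_mul hu
  refine ⟨((ha u).div (hb u) h2).congr ?_, by rw [h u h2]; exact div_ne_zero h1 h2⟩
  filter_upwards [(hb u).continuousAt.eventually_ne h2] with z hz using (h z hz).symm

lemma Mero.good' {F : (Fin n → ℂ) → ℂ} (hF : Mero F) : 
    ∃ H : (Fin n → ℂ) → ℂ, (∀ u, AnalyticAt ℂ H u) ∧ (∃ u, H u ≠ 0) ∧
      ∀ u, H u ≠ 0 → AnalyticAt ℂ F u := by
  obtain ⟨a, b, ha, hb, hb0, h⟩ := hF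
  refine ⟨b, hb, hb0, fun u h2 => ((ha u).div (hb u) h2).congr ?_⟩
  filter_upwards [(hb u).continuousAt.eventually_ne h2] with z hz using (h z hz).symm

end mero

lemma removable_finset (E : Finset ℂ) : ∀ (q : ℂ → ℂ), (∀ s, s ∉ E → DifferentiableAt ℂ q s) →
    (∀ e ∈ E, ∃ C : ℝ, ∀ᶠ z in 𝓝[≠] e, ‖q z‖ ≤ C) →
    ∃ q' : ℂ → ℂ, Differentiable ℂ q' ∧ ∀ s, s ∉ E → q' s = q s := by
  classical
  induction E using Finset.induction_on with
  | empty => exact fun q h _ => ⟨q, fun s => h s (by simp), fun s _ => rfl⟩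
  | insert e E he ih =>
    intro q hd hb
    set f1 := Function.update q e (limUnder (𝓝[≠] e) q) with hf1
    have hne : ∀ s, s ≠ e → f1 =ᶠ[𝓝 s] q := by
      intro s hs
      filter_upwards [isOpen_ne.mem_nhds hs] with z hz
      simp [hf1, Function.update_of_ne hz]
    have hA : ∀ s, s ∉ E → DifferentiableAt ℂ f1 s := by
      intro s hs
      by_cases hse : s = e
      · subst hse
        obtain ⟨C, hC⟩ := hb s (by simp)
        rw [eventually_nhdsWithin_iff] at hC
        have hE : ∀ᶠ z in 𝓝 s, z ∉ E := 
          (E.finite_toSet.isClosed.isOpen_compl).mem_nhds (by simpa using hs)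
        have hmem : {z | (z ∈ ({s}ᶜ : Set ℂ) → ‖q z‖ ≤ C) ∧ z ∉ E} ∈ 𝓝 s := hC.and hE
        have := Complex.differentiableOn_update_limUnder_of_bddAbove (f := q) hmem ?_ ?_
        · exact this.differentiableAt hmem
        · rintro z ⟨hz, hzs⟩
          refine (hd z ?_).differentiableWithinAt
          simp only [Finset.mem_insert, not_or]
          exact ⟨hzs, hz.2⟩
        · refine ⟨C, ?_⟩
          rintro _ ⟨z, ⟨hz, hzs⟩, rfl⟩
          exact hz.1 hzs
      · exact (hd s (by simp [hse, hs])).congr_of_eventuallyEq (hne s hse)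
    have hB : ∀ e ∈ E, ∃ C : ℝ, ∀ᶠ z in 𝓝[≠] e, ‖f1 z‖ ≤ C := by
      intro e' he'
      obtain ⟨C, hC⟩ := hb e' (by simp [he'])
      refine ⟨C, ?_⟩
      have hee : e' ≠ e := fun h => he (h ▸ he')
      filter_upwards [hC, (hne e' hee).filter_mono nhdsWithin_le_nhds] with z h1 h2
      rw [h2]; exact h1
    obtain ⟨q', h1, h2⟩ := ih f1 hA hB
    refine ⟨q', h1, fun s hs => ?_⟩
    simp only [Finset.mem_insert, not_or] at hs
    rw [h2 s hs.2]
    exact (hne s hs.1).self_of_nhds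

lemma liouville_finset (E : Finset ℂ) (q : ℂ → ℂ) (hd : ∀ s, s ∉ E → DifferentiableAt ℂ q s)
    (C : ℝ) (N : ℕ) (hb : ∀ s, s ∉ E → ‖q s‖ ≤ C * (1 + ‖s‖) ^ N) :
    ∃ q' : ℂ → ℂ, Differentiable ℂ q' ∧ (∀ s, s ∉ E → q' s = q s) ∧
      ∀ m, N < m → iteratedDeriv m q' 0 = 0 := by
  classical
  obtain ⟨q', h1, h2⟩ := removable_finset E q hd (by
    intro e he
    refine ⟨|C| * (2 + ‖e‖) ^ N, ?_⟩
    have hE : ∀ᶠ z in 𝓝 e, z ∉ E.erase e := 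
      ((E.erase e).finite_toSet.isClosed.isOpen_compl).mem_nhds (by simp)
    filter_upwards [self_mem_nhdsWithin, hE.filter_mono nhdsWithin_le_nhds,
      mem_nhdsWithin_of_mem_nhds (Metric.ball_mem_nhds e one_pos)] with z hz hz2 hz3
    have hzE : z ∉ E := fun h => hz2 (by simp [h]; exact hz)
    refine (hb z hzE).trans ?_
    have : ‖z‖ ≤ 1 + ‖e‖ := by
      have := norm_sub_norm_le z e
      rw [Metric.mem_ball, dist_eq_norm] at hz3
      linarith
    exact mul_le_mul (le_abs_self C) (pow_le_pow_left₀ (by positivity) (by linarith) N)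
      (by positivity) (abs_nonneg C))
  refine ⟨q', h1, h2, fun m hm => ?_⟩
  have hC : 0 ≤ |C| := abs_nonneg C
  -- eventually in R, the Cauchy estimate
  have key : ∀ᶠ R : ℝ in atTop, ‖iteratedDeriv m q' 0‖ ≤ m.factorial * |C| * 2 ^ N * R⁻¹ := by
    have hlarge : ∀ᶠ R : ℝ in atTop, ∀ e ∈ E, ‖e‖ < R := by
      rw [eventually_all_finset]
      intro e _
      exact eventually_gt_atTop _
    filter_upwards [hlarge, eventually_ge_atTop 1] with R hR hR1
    have h3 := Complex.norm_iteratedDeriv_le_of_forall_mem_sphere_norm_le (c := 0) (R := R)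
      (f := q') (C := |C| * (2 * R) ^ N) m (by linarith) h1.diffContOnCl (by
        intro z hz
        have hz' : ‖z‖ = R := by simpa using hz
        have hzE : z ∉ E := fun h => absurd (hR z h) (by simp [hz'])
        rw [h2 z hzE]
        refine (hb z hzE).trans ?_
        rw [hz']
        exact mul_le_mul (le_abs_self C) (pow_le_pow_left₀ (by positivity) (by linarith) N)
          (by positivity) (abs_nonneg C))
    refine h3.trans ?_
    have hR0 : 0 < R := by linarith
    obtain ⟨k, rfl⟩ : ∃ k, m = N + 1 + k := ⟨m - (N+1), by omega⟩
    rw [mul_pow, pow_add, pow_add, div_le_iff₀ (by positivity)]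
    have : (1:ℝ) ≤ R ^ k := one_le_pow₀ hR1
    have e1 : ((N+1+k).factorial : ℝ) * |C| * 2 ^ N * R⁻¹ * (R ^ N * R ^ 1 * R ^ k) =
      ((N+1+k).factorial : ℝ) * (|C| * (2 ^ N * R ^ N)) * R ^ k := by field_simp
    rw [e1]
    exact le_mul_of_one_le_right (by positivity) this
  have lim : Tendsto (fun R : ℝ => m.factorial * |C| * 2 ^ N * R⁻¹) atTop (𝓝 0) := by
    simpa using tendsto_inv_atTop_zero.const_mul ((m.factorial : ℝ) * |C| * 2 ^ N)
  have := ge_of_tendsto lim key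
  simpa using this

/-- Evaluation of a polynomial in `t` over `ℂ[x]`. -/
noncomputable def ev {n : ℕ} (P : Polynomial (MvPolynomial (Fin n) ℂ)) (x : Fin n → ℂ) (t : ℂ) : ℂ :=
  (P.map (eval x)).eval t

section ev
variable {n : ℕ}
lemma ev_option (P : MvPolynomial (Option (Fin n)) ℂ) (x : Fin n → ℂ) (t : ℂ) :
    ev (optionEquivLeft ℂ (Fin n) P) x t = eval (fun i => Option.elim i t x) P :=
  (optionEquivLeft_elim_eval ℂ (Fin n) x t P).symm

lemma ev_option' (P : Polynomial (MvPolynomial (Fin n) ℂ)) (x : Fin n → ℂ) (t : ℂ) :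
    ev P x t = eval (fun i => Option.elim i t x) ((optionEquivLeft ℂ (Fin n)).symm P) := by
  rw [← ev_option, AlgEquiv.apply_symm_apply]

lemma ev_add (P Q : Polynomial (MvPolynomial (Fin n) ℂ)) (x t) : ev (P + Q) x t = ev P x t + ev Q x t := by
  simp [ev]
lemma ev_mul (P Q : Polynomial (MvPolynomial (Fin n) ℂ)) (x t) : ev (P * Q) x t = ev P x t * ev Q x t := by
  simp [ev]
lemma ev_C (a : MvPolynomial (Fin n) ℂ) (x t) : ev (Polynomial.C a) x t = eval x a := by
  simp [ev]

lemma ev_analyticAt {E : Type*} [NormedAddCommGroup E] [NormedSpace ℂ E]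
    (P : Polynomial (MvPolynomial (Fin n) ℂ)) {x : E → Fin n → ℂ} {t : E → ℂ} {z : E}
    (hx : ∀ j, AnalyticAt ℂ (fun z => x z j) z) (ht : AnalyticAt ℂ t z) :
    AnalyticAt ℂ (fun z => ev P (x z) (t z)) z := by
  have := analyticAt_mvpoly ((optionEquivLeft ℂ (Fin n)).symm P)
    (fun i z => Option.elim i (t z) (x z)) z (by
      intro i; cases i with
      | none => exact ht
      | some j => exact hx j)
  refine this.congr (Eventually.of_forall fun z => ?_)
  simp only [ev_option']

lemma ev_mero (P : Polynomial (MvPolynomial (Fin n) ℂ)) {φ : Fin n → (Fin n → ℂ) → ℂ} {θ : (Fin n → ℂ) → ℂ}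
    (hφ : ∀ j, Mero (φ j)) (hθ : Mero θ) : Mero (fun u => ev P (fun j => φ j u) (θ u)) := by
  have := Mero.mvpoly ((optionEquivLeft ℂ (Fin n)).symm P)
    (F := fun i z => Option.elim i (θ z) (fun j => φ j z)) (by
      intro i; cases i with
      | none => exact hθ
      | some j => exact hφ j)
  convert this using 2
  simp only [ev_option']
end ev

lemma local_inverse {n : ℕ} (φ : Fin n → (Fin n → ℂ) → ℂ) (u0 : Fin n → ℂ)
    (hφ : ∀ j, AnalyticAt ℂ (φ j) u0) (hdet : Matrix.det (Matrix.of fun k p => pd (φ k) p u0) ≠ 0) :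
    ∃ ι : (Fin n → ℂ) → (Fin n → ℂ), AnalyticAt ℂ ι (fun j => φ j u0) ∧ ι (fun j => φ j u0) = u0 ∧
      (∀ᶠ x in 𝓝 (fun j => φ j u0), (fun j => φ j (ι x)) = x) ∧
      (∀ᶠ u in 𝓝 u0, ι (fun j => φ j u) = u) := by
  set Φ : (Fin n → ℂ) → (Fin n → ℂ) := fun u j => φ j u with hΦ
  have hΦa : AnalyticAt ℂ Φ u0 := AnalyticAt.pi hφ
  set L := fderiv ℂ Φ u0 with hL
  have hLapp : ∀ v i, L v i = fderiv ℂ (φ i) u0 v := by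
    intro v i
    rw [hL, fderiv_pi (fun j => (hφ j).differentiableAt)]
    rfl
  have hLdet : L.det ≠ 0 := by
    have : (L : (Fin n → ℂ) →ₗ[ℂ] (Fin n → ℂ)) = Matrix.toLin' (Matrix.of fun k p => pd (φ k) p u0) := by
      apply LinearMap.pi_ext'
      intro p
      ext i
      simp [hLapp, pd]
    rw [ContinuousLinearMap.det, this, LinearMap.det_toLin']
    exact hdet
  let L' := L.toContinuousLinearEquivOfDetNeZero hLdet
  have hL' : HasFDerivAt Φ (L' : (Fin n → ℂ) →L[ℂ] (Fin n → ℂ)) u0 := by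
    simp only [L', ContinuousLinearMap.coe_toContinuousLinearEquivOfDetNeZero]
    exact hΦa.differentiableAt.hasFDerivAt
  have hcd : ContDiffAt ℂ (⊤ : WithTop ℕ∞) Φ u0 := hΦa.contDiffAt
  have hs := hcd.hasStrictFDerivAt' hL' (by simp)
  refine ⟨hcd.localInverse hL' (by simp), ?_, ?_, ?_, ?_⟩
  · have := hcd.to_localInverse hL' (by simp)
    exact this.analyticAt
  · exact hcd.localInverse_apply_image hL' (by simp)
  · exact hs.eventually_right_inverse
  · exact hs.eventually_left_inverse

section branch
variable {n : ℕ}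

lemma branch_one (V : Polynomial (MvPolynomial (Fin n) ℂ)) (x1 : Fin n → ℂ) (r : ℂ)
    (hr : ev V x1 r = 0) (hsep : ev V.derivative x1 r ≠ 0) :
    ∃ τ : (Fin n → ℂ) → ℂ, AnalyticAt ℂ τ x1 ∧ τ x1 = r ∧ ∀ᶠ x in 𝓝 x1, ev V x (τ x) = 0 := by
  set F : (Fin n → ℂ) × ℂ → ℂ := fun z => ev V z.1 z.2 with hF
  have hFa : AnalyticAt ℂ F (x1, r) := by
    refine ev_analyticAt V (fun j => ?_) analyticAt_snd
    exact (coord_ana j _).fun_comp analyticAt_fst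
  have hcd : ContDiffAt ℂ (⊤ : WithTop ℕ∞) F (x1, r) := hFa.contDiffAt
  have hinv : (fderiv ℂ F (x1, r) ∘L .inr ℂ (Fin n → ℂ) ℂ).IsInvertible := by
    have hd : HasDerivAt (fun t : ℂ => ev V x1 t) (fderiv ℂ F (x1, r) ((0 : Fin n → ℂ), (1:ℂ))) r := by
      have h1 := hFa.differentiableAt.hasFDerivAt
      have h2 : HasDerivAt (fun t : ℂ => (x1, t)) ((0 : Fin n → ℂ), (1 : ℂ)) r :=
        (hasDerivAt_const r x1).prodMk (hasDerivAt_id r)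
      exact h1.comp_hasDerivAt r h2
    have hd2 : HasDerivAt (fun t : ℂ => ev V x1 t) (ev V.derivative x1 r) r := by
      have := (V.map (eval x1)).hasDerivAt r
      simpa [ev, Polynomial.derivative_map] using this
    have he := hd.unique hd2
    refine ⟨ContinuousLinearEquiv.unitsEquivAut ℂ (Units.mk0 _ hsep), ?_⟩
    ext
    simp [he]
  refine ⟨hcd.implicitFunction (by simp) hinv, ?_, ?_, ?_⟩
  · exact (hcd.contDiffAt_implicitFunction (by simp) hinv).analyticAt
  · exact hcd.implicitFunction_apply_self (by simp) hinv
  · have := hcd.eventually_apply_implicitFunction (by simp) hinv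
    filter_upwards [this] with x hx
    simp only [hF] at hx
    rw [hx, hr]

lemma branches (V : Polynomial (MvPolynomial (Fin n) ℂ)) (x1 : Fin n → ℂ)
    (hlc : eval x1 V.leadingCoeff ≠ 0) (hsep : ∀ t, ev V x1 t = 0 → ev V.derivative x1 t ≠ 0) :
    ∃ (Z : Finset ℂ) (τ : ℂ → (Fin n → ℂ) → ℂ), (∀ r ∈ Z, AnalyticAt ℂ (τ r) x1 ∧ τ r x1 = r) ∧
      ∀ᶠ x in 𝓝 x1, (∀ t, ev V x t = 0 ↔ ∃ r ∈ Z, τ r x = t) ∧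
        Set.InjOn (fun r => τ r x) Z := by
  classical
  have hm0 : ∀ x, eval x V.leadingCoeff ≠ 0 → V.map (eval x) ≠ 0 := by
    intro x hx h
    have := congrArg (fun p => p.coeff V.natDegree) h
    simp at this
    exact hx this
  set p1 := V.map (eval x1) with hp1
  have hp10 : p1 ≠ 0 := hm0 x1 hlc
  set Z := p1.roots.toFinset with hZ
  have hZmem : ∀ r, r ∈ Z ↔ ev V x1 r = 0 := by
    intro r
    simp only [hZ, Multiset.mem_toFinset, Polynomial.mem_roots hp10]
    rfl
  have hnodup : p1.roots.Nodup := by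
    rw [Multiset.nodup_iff_count_le_one]
    intro r
    rw [Polynomial.count_roots]
    by_contra hc
    push Not at hc
    rw [Polynomial.one_lt_rootMultiplicity_iff_isRoot hp10] at hc
    refine hsep r hc.1 ?_
    have := hc.2
    rwa [hp1, Polynomial.derivative_map] at this
  have hdeg : ∀ x, eval x V.leadingCoeff ≠ 0 → (V.map (eval x)).natDegree = V.natDegree := by
    intro x hx
    exact Polynomial.natDegree_map_of_leadingCoeff_ne_zero _ hx
  have hZcard : Z.card = V.natDegree := by
    rw [hZ, Multiset.toFinset_card_of_nodup hnodup, ← hdeg x1 hlc]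
    exact (IsAlgClosed.card_roots_eq_natDegree (p := p1))
  have hex : ∀ r : ℂ, ∃ τ : (Fin n → ℂ) → ℂ, r ∈ Z → AnalyticAt ℂ τ x1 ∧ τ x1 = r ∧
      ∀ᶠ x in 𝓝 x1, ev V x (τ x) = 0 := by
    intro r
    by_cases hr : r ∈ Z
    · obtain ⟨τ, h⟩ := branch_one V x1 r ((hZmem r).1 hr) (hsep r ((hZmem r).1 hr))
      exact ⟨τ, fun _ => h⟩
    · exact ⟨0, fun h => absurd h hr⟩
  choose τ hτ using hex
  refine ⟨Z, τ, fun r hr => ⟨(hτ r hr).1, (hτ r hr).2.1⟩, ?_⟩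
  have e1 : ∀ᶠ x in 𝓝 x1, ∀ r ∈ Z, ev V x (τ r x) = 0 := by
    rw [eventually_all_finset]
    exact fun r hr => (hτ r hr).2.2
  have e2 : ∀ᶠ x in 𝓝 x1, ∀ r ∈ Z, ∀ r' ∈ Z, r ≠ r' → τ r x ≠ τ r' x := by
    rw [eventually_all_finset]
    intro r hr
    rw [eventually_all_finset]
    intro r' hr'
    by_cases h : r = r'
    · exact Eventually.of_forall fun _ h' => absurd h h'
    · have := (((hτ r hr).1.sub (hτ r' hr').1).continuousAt).eventually_ne (y := 0) (by
        simp [(hτ r hr).2.1, (hτ r' hr').2.1, sub_eq_zero, h])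
      filter_upwards [this] with x hx _
      simpa [sub_eq_zero] using hx
  have e3 : ∀ᶠ x in 𝓝 x1, eval x V.leadingCoeff ≠ 0 :=
    (mvpoly_ent V.leadingCoeff x1).continuousAt.eventually_ne hlc
  filter_upwards [e1, e2, e3] with x h1 h2 h3
  have hinj : Set.InjOn (fun r => τ r x) Z := by
    intro r hr r' hr' h
    by_contra hne
    exact h2 r hr r' hr' hne h
  refine ⟨?_, hinj⟩
  have hsub : Z.image (fun r => τ r x) ⊆ (V.map (eval x)).roots.toFinset := by
    intro t ht
    obtain ⟨r, hr, rfl⟩ := Finset.mem_image.1 ht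
    simp only [Multiset.mem_toFinset, Polynomial.mem_roots (hm0 x h3)]
    exact h1 r hr
  have heq := Finset.eq_of_subset_of_card_le hsub (by
    rw [Finset.card_image_of_injOn hinj, hZcard, ← hdeg x h3]
    exact (Multiset.toFinset_card_le _).trans (Polynomial.card_roots' _))
  intro t
  have : t ∈ (V.map (eval x)).roots.toFinset ↔ ev V x t = 0 := by
    simp only [Multiset.mem_toFinset, Polynomial.mem_roots (hm0 x h3)]
    rfl
  rw [← this, ← heq]
  simp
end branch

lemma clear_denoms {R : Type*} [CommRing R] [IsDomain R] (a : Polynomial (FractionRing R)) :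
    ∃ (c : R) (a' : Polynomial R), c ≠ 0 ∧
      a'.map (algebraMap R (FractionRing R)) = Polynomial.C (algebraMap R (FractionRing R) c) * a := by
  obtain ⟨b, hb, h⟩ := IsLocalization.integerNormalization_spec (nonZeroDivisors R) a
  refine ⟨b, _, nonZeroDivisors.ne_zero hb, h.trans ?_⟩
  ext i
  simp [Algebra.smul_def]

lemma alg_good {R S : Type*} [CommRing R] [IsDomain R] [CharZero R] [CommRing S] [IsDomain S] [Algebra R S]
    [FaithfulSMul R S] (s : S) (hs : IsAlgebraic R s) :
    ∃ V : Polynomial R, V ≠ 0 ∧ Polynomial.aeval s V = 0 ∧ Polynomial.aeval s V.derivative ≠ 0 ∧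
      ∀ Q, Polynomial.aeval s Q ≠ 0 → ∃ (A B : Polynomial R) (N : R), N ≠ 0 ∧
        A * V + B * Q = Polynomial.C N := by
  let K := FractionRing R
  let L := FractionRing S
  let : Algebra K L := FractionRing.liftAlgebra R L
  have : IsScalarTower R K L := FractionRing.isScalarTower_liftAlgebra R L
  let x : L := algebraMap S L s
  have hxs : ∀ Q : Polynomial R, Polynomial.aeval x (Q.map (algebraMap R K)) =
      algebraMap S L (Polynomial.aeval s Q) := by
    intro Q
    rw [Polynomial.aeval_map_algebraMap]
    exact Polynomial.aeval_algebraMap_apply L s Q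
  have hinjL : Function.Injective (algebraMap S L) := IsFractionRing.injective S L
  have hinjK : Function.Injective (algebraMap R K) := IsFractionRing.injective R K
  have hx : IsAlgebraic K x := by
    obtain ⟨p, hp, h⟩ := hs
    refine ⟨p.map (algebraMap R K), ?_, ?_⟩
    · rwa [Ne, Polynomial.map_eq_zero_iff hinjK]
    · rw [hxs, h, map_zero]
  have : CharZero K := charZero_of_injective_algebraMap hinjK
  have hIntegral := hx.isIntegral
  have hirr := minpoly.irreducible hIntegral
  obtain ⟨b, V, hb, hV⟩ := clear_denoms (minpoly K x)
  have hb' : algebraMap R K b ≠ 0 := by rwa [Ne, map_eq_zero_iff _ hinjK]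
  refine ⟨V, ?_, ?_, ?_, ?_⟩
  · rintro rfl
    simp at hV
    rcases hV with h | h
    · exact hb h
    · exact minpoly.ne_zero hIntegral h
  · apply hinjL
    rw [← hxs, hV]; simp
  · intro h
    have h2 := hxs V.derivative
    rw [h, map_zero, ← Polynomial.derivative_map, hV] at h2
    simp only [Polynomial.derivative_C_mul, map_mul, Polynomial.aeval_C] at h2
    have hsep : (minpoly K x).Separable := hirr.separable
    have := hsep.aeval_derivative_ne_zero (minpoly.aeval K x)
    rcases mul_eq_zero.1 h2 with h3 | h3
    · exact hb' ((map_eq_zero_iff _ (algebraMap K L).injective).1 h3)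
    · exact this h3
  · intro Q hQ
    have hQ' : ¬ minpoly K x ∣ Q.map (algebraMap R K) := by
      intro h
      have := (minpoly.dvd_iff).1 h
      rw [hxs, map_eq_zero_iff _ hinjL] at this
      exact hQ this
    obtain ⟨a, c, hac⟩ := (hirr.coprime_iff_not_dvd).2 hQ'
    obtain ⟨ca, a', hca, ha'⟩ := clear_denoms a
    obtain ⟨cc, c', hcc, hc'⟩ := clear_denoms c
    refine ⟨Polynomial.C cc * a', Polynomial.C (ca * b) * c', ca * b * cc, by simp [hca, hb, hcc], ?_⟩
    apply Polynomial.map_injective _ hinjK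
    simp only [Polynomial.map_add, Polynomial.map_mul, Polynomial.map_C, map_mul]
    have e1 : Polynomial.map (algebraMap R K) a' = Polynomial.C (algebraMap R K ca) * a := ha'
    have e2 : Polynomial.map (algebraMap R K) c' = Polynomial.C (algebraMap R K cc) * c := hc'
    have e3 : Polynomial.map (algebraMap R K) V = Polynomial.C (algebraMap R K b) * minpoly K x := hV
    rw [e1, e2, e3]
    linear_combination (Polynomial.C (algebraMap R K ca) * Polynomial.C (algebraMap R K b) * Polynomial.C (algebraMap R K cc)) * hac

section exch
variable {A : Type*} [CommRing A] [IsDomain A] [Algebra ℂ A]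
open AlgebraicIndependent Algebra

lemma alg_iff_closure {s : Set A} {a : A} :
    IsAlgebraic (adjoin ℂ s) a ↔ a ∈ (matroid ℂ A).closure s := by
  rw [matroid_closure_eq]
  simp only [SetLike.mem_coe]
  exact Iff.rfl

lemma exch_alg {ι : Type*} [Fintype ι] (x y : ι → A) (hx : AlgebraicIndependent ℂ x)
    (hy : AlgebraicIndependent ℂ y)
    (h : ∀ i, IsAlgebraic (adjoin ℂ (Set.range x)) (y i)) :
    ∀ i, IsAlgebraic (adjoin ℂ (Set.range y)) (x i) := by
  classical
  have hJ : (matroid ℂ A).Indep (Set.range x) := hx.to_subtype_range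
  have hI : (matroid ℂ A).Indep (Set.range y) := hy.to_subtype_range
  have hsub : Set.range y ⊆ (matroid ℂ A).closure (Set.range x) := by
    rintro _ ⟨i, rfl⟩
    exact alg_iff_closure.1 (h i)
  obtain ⟨I', hI', hII'⟩ := hI.subset_isBasis_of_subset hsub
  have hc := hI'.encard_eq_encard hJ.isBasis_closure
  have cx : (Set.range x).encard = Fintype.card ι := by
    rw [← Set.image_univ, hx.injective.encard_image]; simp
  have cy : (Set.range y).encard = Fintype.card ι := by
    rw [← Set.image_univ, hy.injective.encard_image]; simp
  have heq : Set.range y = I' := by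
    refine Set.Finite.eq_of_subset_of_encard_le ?_ hII' ?_
    · rw [← Set.encard_lt_top_iff, cy]; simp
    · rw [hc, cx, cy]
  intro i
  rw [alg_iff_closure, heq, hI'.closure_eq_closure, Matroid.closure_closure]
  exact (matroid ℂ A).subset_closure _ (by simp) (Set.mem_range_self i)

lemma chain_alg {ι : Type*} [Fintype ι] (X Y Z Z' : ι → A) (f : A)
    (h1 : AlgebraicIndependent ℂ (Sum.elim X Y)) (h2 : AlgebraicIndependent ℂ (Sum.elim X Z))
    (h3 : ∀ i, IsAlgebraic (adjoin ℂ (Set.range (Sum.elim X Y))) (Z i))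
    (h4 : IsAlgebraic (adjoin ℂ (Set.range (Sum.elim Z' Y))) f) :
    IsAlgebraic (adjoin ℂ (Set.range (Sum.elim X (Sum.elim Z Z')))) f := by
  have h5 := exch_alg _ _ h1 h2 (by
    rintro (i | i)
    · simp only [Sum.elim_inl]
      rw [alg_iff_closure]
      exact (matroid ℂ A).subset_closure _ (by simp) ⟨Sum.inl i, rfl⟩
    · exact h3 i)
  rw [alg_iff_closure] at h4 ⊢
  refine (matroid ℂ A).closure_subset_closure_of_subset_closure ?_ h4
  rintro _ ⟨i | i, rfl⟩
  · exact (matroid ℂ A).subset_closure _ (by simp) ⟨Sum.inr (Sum.inr i), rfl⟩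
  · have := h5 (Sum.inr i)
    rw [alg_iff_closure] at this
    refine (matroid ℂ A).closure_subset_closure ?_ this
    rintro _ ⟨j | j, rfl⟩
    · exact ⟨Sum.inl j, rfl⟩
    · exact ⟨Sum.inr (Sum.inl j), rfl⟩

lemma alg_of_rel {ι : Type*} (x : ι → A) (hx : AlgebraicIndependent ℂ x) (z : A)
    (G : MvPolynomial (Option ι) ℂ) (hG : G ≠ 0) (h : aeval (fun o => Option.elim o z x) G = 0) :
    IsAlgebraic (adjoin ℂ (Set.range x)) z := by
  by_contra hc
  have := (hx.option_iff_transcendental z).2 hc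
  exact hG ((algebraicIndependent_iff.1 this) G h)

lemma lift_poly {ι : Type*} (x : ι → A) (z : A) (h : IsAlgebraic (adjoin ℂ (Set.range x)) z) :
    ∃ P : Polynomial (MvPolynomial ι ℂ), aeval x P.leadingCoeff ≠ 0 ∧
      P.eval₂ (aeval x : MvPolynomial ι ℂ →ₐ[ℂ] A).toRingHom z = 0 := by
  obtain ⟨p, hp, h⟩ := h
  have hsurj : ∀ a : adjoin ℂ (Set.range x), ∃ q : MvPolynomial ι ℂ, aeval x q = (a : A) := by
    intro a
    have h2 : ∀ b ∈ adjoin ℂ (Set.range x), ∃ q : MvPolynomial ι ℂ, aeval x q = b := by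
      intro b hb
      rw [Algebra.adjoin_range_eq_range_aeval] at hb
      exact hb
    exact h2 a a.2
  choose σ hσ using hsurj
  set P : Polynomial (MvPolynomial ι ℂ) := ∑ i ∈ Finset.range (p.natDegree + 1), Polynomial.monomial i (σ (p.coeff i)) with hP
  have hcoef : P.coeff p.natDegree = σ (p.coeff p.natDegree) := by
    simp [hP, Polynomial.coeff_monomial]
  have hle : P.natDegree ≤ p.natDegree := by
    apply Polynomial.natDegree_sum_le_of_forall_le
    intro i hi
    exact (Polynomial.natDegree_monomial_le _).trans (by simpa [Nat.lt_succ_iff] using hi)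
  have hne : aeval x (P.coeff p.natDegree) ≠ 0 := by
    rw [hcoef, hσ]
    simpa using hp
  have hdeg : P.natDegree = p.natDegree :=
    le_antisymm hle (Polynomial.le_natDegree_of_ne_zero fun h => hne (by simp [h]))
  refine ⟨P, ?_, ?_⟩
  · rw [Polynomial.leadingCoeff, hdeg]; exact hne
  · rw [hP, Polynomial.eval₂_finsetSum]
    rw [Polynomial.aeval_eq_sum_range] at h
    rw [← h]
    refine Finset.sum_congr rfl fun i _ => ?_
    rw [Polynomial.eval₂_monomial]
    rw [Algebra.smul_def]
    congr 1
    exact hσ _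
end exch

section holo
variable {E : Type*} [NormedAddCommGroup E] [NormedSpace ℂ E]
/-- Ring of holomorphic functions on a set. -/
def holo (Ω : Set E) : Subalgebra ℂ (Ω → ℂ) where
  carrier := {f | ∃ F : E → ℂ, AnalyticOnNhd ℂ F Ω ∧ ∀ z : Ω, f z = F z}
  mul_mem' := by
    rintro f g ⟨F, hF, h⟩ ⟨G, hG, h'⟩
    exact ⟨fun z => F z * G z, fun z hz => (hF z hz).fun_mul (hG z hz), fun z => by simp [h, h']⟩
  add_mem' := by
    rintro f g ⟨F, hF, h⟩ ⟨G, hG, h'⟩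
    exact ⟨fun z => F z + G z, fun z hz => (hF z hz).fun_add (hG z hz), fun z => by simp [h, h']⟩
  algebraMap_mem' r := ⟨fun _ => r, fun _ _ => analyticAt_const, fun z => rfl⟩

lemma holo_domain {Ω : Set E} (ho : IsOpen Ω) (hp : IsPreconnected Ω) (hne : Ω.Nonempty) :
    IsDomain (holo Ω) := by
  have : Nontrivial (holo Ω) := by
    obtain ⟨z, hz⟩ := hne
    refine ⟨0, 1, fun h => ?_⟩
    have := congrArg (fun f : holo Ω => f.1 ⟨z, hz⟩) h
    simp at this
  have : NoZeroDivisors (holo Ω) := by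
    refine ⟨?_⟩
    rintro ⟨f, F, hF, h⟩ ⟨g, G, hG, h'⟩ hfg
    by_contra hc
    push Not at hc
    have nz : ∀ (f : Ω → ℂ) (hf : f ∈ holo Ω) (F : E → ℂ), (∀ z : Ω, f z = F z) →
      (⟨f, hf⟩ : holo Ω) ≠ 0 → ∃ u ∈ Ω, F u ≠ 0 := by
      intro f hf F h h0
      by_contra hcc
      push Not at hcc
      apply h0
      ext z
      simp [h, hcc z z.2]
    obtain ⟨u, hu, h1, h2⟩ := ana_mul hF hG hp ho (nz _ _ F h hc.1) (nz _ _ G h' hc.2)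
    have := congrArg (fun f : holo Ω => f.1 ⟨u, hu⟩) hfg
    simp [h, h', h1, h2] at this
  exact NoZeroDivisors.to_isDomain _

/-- an element of the ring of holomorphic functions -/
def mkH {Ω : Set E} (F : E → ℂ) (hF : AnalyticOnNhd ℂ F Ω) : holo Ω := ⟨fun z => F z, F, hF, fun _ => rfl⟩

/-- evaluation at a point -/
def evH {Ω : Set E} (z : Ω) : holo Ω →ₐ[ℂ] ℂ := (Pi.evalAlgHom ℂ (fun _ : Ω => ℂ) z).comp (holo Ω).val

@[simp] lemma evH_mk {Ω : Set E} (z : Ω) (F : E → ℂ) (hF : AnalyticOnNhd ℂ F Ω) : evH z (mkH F hF) = F z := rfl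

lemma holo_ext {Ω : Set E} (f g : holo Ω) (h : ∀ z, evH z f = evH z g) : f = g :=
  Subtype.ext (funext h)

lemma evH_aeval {Ω : Set E} (z : Ω) {σ : Type*} (x : σ → holo Ω) (P : MvPolynomial σ ℂ) :
    evH z (aeval x P) = eval (fun i => evH z (x i)) P := by
  rw [MvPolynomial.comp_aeval_apply]
  exact congrArg (fun f : MvPolynomial σ ℂ →+* ℂ => f P) (MvPolynomial.coe_aeval_eq_eval _)
end holo

section norel
variable {n : ℕ}

lemma mvpoly_zero_of_eventually {σ : Type*} [Fintype σ] (P : MvPolynomial σ ℂ) (y0 : σ → ℂ)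
    (h : ∀ᶠ y in 𝓝 y0, eval y P = 0) : P = 0 := by
  have ha : ∀ y : σ → ℂ, AnalyticAt ℂ (fun y : σ → ℂ => eval y P) y := fun y => 
    analyticAt_mvpoly P (fun i (z : σ → ℂ) => z i) y
      (fun i => ContinuousLinearMap.analyticAt (ContinuousLinearMap.proj (R := ℂ) (φ := fun _ : σ => ℂ) i) y)
  have := ent_eq (w := y0) ha (g := fun _ => 0) (fun _ => analyticAt_const) h
  exact MvPolynomial.funext fun y => by simpa using congrFun this y

lemma no_rel1 {φ : Fin n → (Fin n → ℂ) → ℂ} {p : Fin n → ℂ} (ap : ∀ j, AnalyticAt ℂ (φ j) p)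
    (dp : Matrix.det (Matrix.of fun k i => pd (φ k) i p) ≠ 0)
    (P : MvPolynomial (Fin n) ℂ) (h : ∀ᶠ u in 𝓝 p, eval (fun j => φ j u) P = 0) : P = 0 := by
  obtain ⟨ι, h1, h2, h3, h4⟩ := local_inverse φ p ap dp
  have hc : Tendsto ι (𝓝 fun j => φ j p) (𝓝 p) := by
    simpa [ContinuousAt, h2] using h1.continuousAt
  apply mvpoly_zero_of_eventually P (fun j => φ j p)
  filter_upwards [h3, hc.eventually h] with y hy1 hy2
  rwa [hy1] at hy2

lemma no_rel {φ : Fin n → (Fin n → ℂ) → ℂ} {p q : Fin n → ℂ} (ap : ∀ j, AnalyticAt ℂ (φ j) p)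
    (dp : Matrix.det (Matrix.of fun k i => pd (φ k) i p) ≠ 0) (aq : ∀ j, AnalyticAt ℂ (φ j) q)
    (dq : Matrix.det (Matrix.of fun k i => pd (φ k) i q) ≠ 0)
    (P : MvPolynomial (Fin n ⊕ Fin n) ℂ)
    (h : ∀ᶠ z in 𝓝 (p, q), eval (Sum.elim (fun j => φ j z.1) (fun j => φ j z.2)) P = 0) : P = 0 := by
  obtain ⟨ι, h1, h2, h3, h4⟩ := local_inverse φ p ap dp
  obtain ⟨κ, k1, k2, k3, k4⟩ := local_inverse φ q aq dq
  have hc : Tendsto ι (𝓝 fun j => φ j p) (𝓝 p) := by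
    simpa [ContinuousAt, h2] using h1.continuousAt
  have kc : Tendsto κ (𝓝 fun j => φ j q) (𝓝 q) := by
    simpa [ContinuousAt, k2] using k1.continuousAt
  set y0 : Fin n ⊕ Fin n → ℂ := Sum.elim (fun j => φ j p) (fun j => φ j q) with hy0
  have t1 : Tendsto (fun (y : Fin n ⊕ Fin n → ℂ) (j : Fin n) => y (Sum.inl j)) (𝓝 y0) (𝓝 fun j => φ j p) := by
    have : Continuous (fun (y : Fin n ⊕ Fin n → ℂ) (j : Fin n) => y (Sum.inl j)) := by fun_prop
    simpa [hy0] using this.tendsto y0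
  have t2 : Tendsto (fun (y : Fin n ⊕ Fin n → ℂ) (j : Fin n) => y (Sum.inr j)) (𝓝 y0) (𝓝 fun j => φ j q) := by
    have : Continuous (fun (y : Fin n ⊕ Fin n → ℂ) (j : Fin n) => y (Sum.inr j)) := by fun_prop
    simpa [hy0] using this.tendsto y0
  apply mvpoly_zero_of_eventually P y0
  have t3 := ((hc.comp t1).prodMk_nhds (kc.comp t2)).eventually h
  filter_upwards [t3, t1.eventually h3, t2.eventually k3] with y hy hy1 hy2
  simp only [Function.comp] at hy
  rw [hy1, hy2] at hy
  convert hy using 2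
  congr 1
  ext i; cases i <;> rfl

lemma indep_holo {φ : Fin n → (Fin n → ℂ) → ℂ} {p q : Fin n → ℂ} (ap : ∀ j, AnalyticAt ℂ (φ j) p)
    (dp : Matrix.det (Matrix.of fun k i => pd (φ k) i p) ≠ 0) (aq : ∀ j, AnalyticAt ℂ (φ j) q)
    (dq : Matrix.det (Matrix.of fun k i => pd (φ k) i q) ≠ 0)
    {Ω : Set ((Fin n → ℂ) × (Fin n → ℂ))} (ho : IsOpen Ω) (F G : Fin n → holo Ω)
    (S : (Fin n → ℂ) × (Fin n → ℂ) → (Fin n → ℂ) × (Fin n → ℂ)) (hS : Continuous S)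
    (hSΩ : S (p, q) ∈ Ω) (h : ∀ z (hz : S z ∈ Ω) j, evH ⟨S z, hz⟩ (F j) = φ j z.1 ∧
      evH ⟨S z, hz⟩ (G j) = φ j z.2) : AlgebraicIndependent ℂ (Sum.elim F G) := by
  rw [algebraicIndependent_iff]
  intro P hP
  apply no_rel ap dp aq dq P
  filter_upwards [hS.continuousAt.preimage_mem_nhds (ho.mem_nhds hSΩ)] with z hz
  have := evH_aeval (⟨S z, hz⟩ : Ω) (Sum.elim F G) P
  rw [hP, map_zero] at this
  rw [this]
  congr 2
  ext i
  cases i with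
  | inl j => simp [(h z hz j).1]
  | inr j => simp [(h z hz j).2]

lemma Mero.det {M : Fin n → Fin n → (Fin n → ℂ) → ℂ} (h : ∀ i j, Mero (M i j)) :
    Mero (fun u => Matrix.det (Matrix.of fun i j => M i j u)) := by
  simp only [Matrix.det_apply, Matrix.of_apply]
  refine Mero.sum _ fun σ _ => ?_
  have := (Mero.const ((Equiv.Perm.sign σ : ℤ) : ℂ)).mul (Mero.prod (n := n) Finset.univ (f := fun i u => M (σ i) i u) (fun i _ => h _ _))
  convert this using 2
  rw [Units.smul_def, zsmul_eq_mul]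

lemma det_analyticAt {E : Type*} [NormedAddCommGroup E] [NormedSpace ℂ E] {M : Fin n → Fin n → E → ℂ} {u : E} (h : ∀ i j, AnalyticAt ℂ (M i j) u) :
    AnalyticAt ℂ (fun u => Matrix.det (Matrix.of fun i j => M i j u)) u := by
  simp only [Matrix.det_apply, Matrix.of_apply]
  refine Finset.analyticAt_fun_sum _ fun σ _ => ?_
  have := (analyticAt_const (𝕜 := ℂ) (x := u) (v := ((Equiv.Perm.sign σ : ℤ) : ℂ))).fun_mul (Finset.analyticAt_fun_prod (f := fun i u => M (σ i) i u) Finset.univ (fun i _ => h (σ i) i))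
  refine this.congr (Eventually.of_forall fun z => ?_)
  beta_reduce
  rw [Units.smul_def, zsmul_eq_mul]

lemma good_prod {ι : Type*} [Fintype ι] (P : ι → (Fin n → ℂ) → Prop)
    (h : ∀ i, ∃ H : (Fin n → ℂ) → ℂ, (∀ u, AnalyticAt ℂ H u) ∧ (∃ u, H u ≠ 0) ∧ ∀ u, H u ≠ 0 → P i u) :
    ∃ H : (Fin n → ℂ) → ℂ, (∀ u, AnalyticAt ℂ H u) ∧ (∃ u, H u ≠ 0) ∧ ∀ u, H u ≠ 0 → ∀ i, P i u := by
  choose H h1 h2 h3 using h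
  refine ⟨fun u => ∏ i, H i u, fun u => Finset.analyticAt_fun_prod _ fun i _ => h1 i u,
    ent_prod _ _ (fun i _ => h1 i) (fun i _ => h2 i), fun u hu i => h3 i u ?_⟩
  exact (Finset.prod_ne_zero_iff.1 hu) i (Finset.mem_univ i)

lemma good_and {P Q : (Fin n → ℂ) → Prop}
    (h : ∃ H : (Fin n → ℂ) → ℂ, (∀ u, AnalyticAt ℂ H u) ∧ (∃ u, H u ≠ 0) ∧ ∀ u, H u ≠ 0 → P u)
    (h' : ∃ H : (Fin n → ℂ) → ℂ, (∀ u, AnalyticAt ℂ H u) ∧ (∃ u, H u ≠ 0) ∧ ∀ u, H u ≠ 0 → Q u) :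
    ∃ H : (Fin n → ℂ) → ℂ, (∀ u, AnalyticAt ℂ H u) ∧ (∃ u, H u ≠ 0) ∧ ∀ u, H u ≠ 0 → P u ∧ Q u := by
  obtain ⟨H, h1, h2, h3⟩ := h
  obtain ⟨K, k1, k2, k3⟩ := h'
  refine ⟨fun u => H u * K u, fun u => (h1 u).fun_mul (k1 u), ent_mul h1 k1 h2 k2, fun u hu => ?_⟩
  exact ⟨h3 u (left_ne_zero_of_mul hu), k3 u (right_ne_zero_of_mul hu)⟩

lemma good_base {φ : Fin n → (Fin n → ℂ) → ℂ} (hmero : ∀ k, Mero (φ k)) (hindep : AnalyticallyIndep φ) :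
    ∃ H : (Fin n → ℂ) → ℂ, (∀ u, AnalyticAt ℂ H u) ∧ (∃ u, H u ≠ 0) ∧ ∀ u, H u ≠ 0 →
      (∀ j, AnalyticAt ℂ (φ j) u) ∧ Matrix.det (Matrix.of fun k p => pd (φ k) p u) ≠ 0 := by
  obtain ⟨w, hw, hd⟩ := hindep
  refine good_and (good_prod _ fun j => (hmero j).good') ?_
  have hdm : Mero (fun u => Matrix.det (Matrix.of fun k p => pd (φ k) p u)) :=
    Mero.det fun i j => (hmero i).pd j
  obtain ⟨H, h1, h2, h3⟩ := hdm.good (w := w)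
    (det_analyticAt fun i j => pd_analyticAt (hw i) j).continuousAt hd
  exact ⟨H, h1, h2, fun u hu => (h3 u hu).2⟩
end norel

lemma aat_neg_alg {n : ℕ} (φ : Fin n → (Fin n → ℂ) → ℂ) (hmero : ∀ k, Mero (φ k))
    (hindep : AnalyticallyIndep φ) (haat : AdmitsAAT φ) (k : Fin n) :
    ∃ W : Polynomial (MvPolynomial (Fin n) ℂ), W ≠ 0 ∧
      ∃ u1, ∀ᶠ u in 𝓝 u1, ev W (fun j => φ j u) (φ k (-u)) = 0 := by
  classical
  obtain ⟨H, hHa, hH0, hH⟩ := good_base hmero hindep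
  have hHn : ∀ u, AnalyticAt ℂ (fun u => H (-u)) u := fun u => (hHa _).fun_comp (analyticAt_neg_fun u)
  have hH1a : ∀ u, AnalyticAt ℂ (fun u => H u * H (-u)) u := fun u => (hHa u).fun_mul (hHn u)
  have hH1 : ∃ u, H u * H (-u) ≠ 0 := ent_mul hHa hHn hH0 (by
    obtain ⟨u, hu⟩ := hH0; exact ⟨-u, by simpa using hu⟩)
  obtain ⟨u0, hu0⟩ := hH1
  have hH2a : ∀ a, AnalyticAt ℂ (fun a => H (a - u0)) a := fun a =>
    (hHa _).fun_comp (analyticAt_id.sub analyticAt_const)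
  obtain ⟨a0, ha0⟩ := ent_mul hH1a hH2a ⟨u0, hu0⟩ (by
    obtain ⟨u, hu⟩ := hH0; exact ⟨u + u0, by simpa using hu⟩)
  have hHc : Continuous H := continuous_iff_continuousAt.2 fun u => (hHa u).continuousAt
  -- the domain
  have hΩ : ∀ᶠ z : (Fin n → ℂ) × (Fin n → ℂ) in 𝓝 (u0, a0),
      H z.1 * H (-z.1) * (H z.2 * H (-z.2) * H (z.2 - z.1)) ≠ 0 := by
    have hc : Continuous fun z : (Fin n → ℂ) × (Fin n → ℂ) =>
      H z.1 * H (-z.1) * (H z.2 * H (-z.2) * H (z.2 - z.1)) := by fun_prop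
    exact hc.continuousAt.eventually_ne (mul_ne_zero hu0 ha0)
  obtain ⟨ε, hε, hb⟩ := Metric.eventually_nhds_iff_ball.1 hΩ
  set Ω := Metric.ball (u0, a0) ε with hΩdef
  have ho : IsOpen Ω := Metric.isOpen_ball
  have hmem : (u0, a0) ∈ Ω := Metric.mem_ball_self hε
  have hpc : IsPreconnected Ω := (convex_ball _ _).isPreconnected
  have hdom : IsDomain (holo Ω) := holo_domain ho hpc ⟨_, hmem⟩
  have hg : ∀ z ∈ Ω, H z.1 ≠ 0 ∧ H (-z.1) ≠ 0 ∧ H z.2 ≠ 0 ∧ H (-z.2) ≠ 0 ∧ H (z.2 - z.1) ≠ 0 := by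
    intro z hz
    have := hb z hz
    simp only [mul_ne_zero_iff] at this
    tauto
  have a1 : ∀ j, AnalyticOnNhd ℂ (fun z : (Fin n → ℂ) × (Fin n → ℂ) => φ j z.1) Ω := fun j z hz =>
    ((hH _ (hg z hz).1).1 j).fun_comp analyticAt_fst
  have a2 : ∀ j, AnalyticOnNhd ℂ (fun z : (Fin n → ℂ) × (Fin n → ℂ) => φ j z.2) Ω := fun j z hz =>
    ((hH _ (hg z hz).2.2.1).1 j).fun_comp analyticAt_snd
  have a3 : ∀ j, AnalyticOnNhd ℂ (fun z : (Fin n → ℂ) × (Fin n → ℂ) => φ j (-z.2)) Ω := fun j z hz =>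
    AnalyticAt.fun_comp (g := φ j) (f := fun z : (Fin n → ℂ) × (Fin n → ℂ) => -z.2) ((hH _ (hg z hz).2.2.2.1).1 j) analyticAt_snd.fun_neg
  have a4 : ∀ j, AnalyticOnNhd ℂ (fun z : (Fin n → ℂ) × (Fin n → ℂ) => φ j (z.2 - z.1)) Ω := fun j z hz =>
    AnalyticAt.fun_comp (g := φ j) (f := fun z : (Fin n → ℂ) × (Fin n → ℂ) => z.2 - z.1) ((hH _ (hg z hz).2.2.2.2).1 j) (analyticAt_snd.fun_sub analyticAt_fst)
  have a5 : AnalyticOnNhd ℂ (fun z : (Fin n → ℂ) × (Fin n → ℂ) => φ k (-z.1)) Ω := fun z hz =>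
    AnalyticAt.fun_comp (g := φ k) (f := fun z : (Fin n → ℂ) × (Fin n → ℂ) => -z.1) ((hH _ (hg z hz).2.1).1 k) analyticAt_fst.fun_neg
  set X : Fin n → holo Ω := fun j => mkH _ (a1 j) with hX
  set Z : Fin n → holo Ω := fun j => mkH _ (a2 j) with hZ
  set Z' : Fin n → holo Ω := fun j => mkH _ (a3 j) with hZ'
  set Y : Fin n → holo Ω := fun j => mkH _ (a4 j) with hY
  set f : holo Ω := mkH _ a5 with hf
  obtain ⟨g1, g2, g3, g4, g5⟩ := hg _ hmem
  have i1 : AlgebraicIndependent ℂ (Sum.elim X Y) := by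
    refine indep_holo (p := u0) (q := a0 - u0) (hH _ g1).1 (hH _ g1).2 (hH _ g5).1 (hH _ g5).2 ho X Y
      (fun z => (z.1, z.1 + z.2)) (by fun_prop) (by simpa using hmem) ?_
    intro z hz j
    simp [hX, hY]
  have i2 : AlgebraicIndependent ℂ (Sum.elim X Z) := by
    refine indep_holo (p := u0) (q := a0) (hH _ g1).1 (hH _ g1).2 (hH _ g3).1 (hH _ g3).2 ho X Z
      (fun z => z) (by fun_prop) (by simpa using hmem) ?_
    intro z hz j
    simp [hX, hZ]
  have i3 : AlgebraicIndependent ℂ (Sum.elim Z' Y) := by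
    refine indep_holo (p := -a0) (q := a0 - u0) (hH _ g4).1 (hH _ g4).2 (hH _ g5).1 (hH _ g5).2 ho Z' Y
      (fun z => (- z.1 - z.2, -z.1)) (by fun_prop) (by simpa using hmem) ?_
    intro z hz j
    simp [hZ', hY]
  have hGne : ∀ {G : MvPolynomial (Option (Fin n ⊕ Fin n)) ℂ}, 1 ≤ G.degreeOf none → G ≠ 0 := by
    rintro G h rfl
    simp at h
  have r1 : ∀ i, IsAlgebraic (Algebra.adjoin ℂ (Set.range (Sum.elim X Y))) (Z i) := by
    intro i
    obtain ⟨G, hG1, hG2⟩ := haat i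
    refine alg_of_rel _ i1 _ G (hGne hG1) (holo_ext _ _ fun z => ?_)
    rw [evH_aeval, map_zero]
    obtain ⟨g1, g2, g3, g4, g5⟩ := hg z z.2
    have := hG2 z.1.1 (z.1.2 - z.1.1) (hH _ g1).1 (hH _ g5).1 (by simpa using (hH _ g3).1 i)
    rw [← this]
    congr 2
    ext o
    rcases o with _ | (j | j) <;> simp [hX, hY, hZ]
  have r2 : IsAlgebraic (Algebra.adjoin ℂ (Set.range (Sum.elim Z' Y))) f := by
    obtain ⟨G, hG1, hG2⟩ := haat k
    refine alg_of_rel _ i3 _ G (hGne hG1) (holo_ext _ _ fun z => ?_)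
    rw [evH_aeval, map_zero]
    obtain ⟨g1, g2, g3, g4, g5⟩ := hg z z.2
    have e : -z.1.2 + (z.1.2 - z.1.1) = - z.1.1 := by abel
    have := hG2 (-z.1.2) (z.1.2 - z.1.1) (hH _ g4).1 (hH _ g5).1 (by rw [e]; exact (hH _ g2).1 k)
    rw [← this]
    congr 2
    ext o
    rcases o with _ | (j | j) <;> simp [hZ', hY, hf, e]
  obtain ⟨P, hP1, hP2⟩ := lift_poly _ _ (chain_alg X Y Z Z' f i1 i2 r1 r2)
  have hnz : ∃ z : Ω, evH z (aeval (Sum.elim X (Sum.elim Z Z')) P.leadingCoeff) ≠ 0 := by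
    by_contra hc
    push Not at hc
    exact hP1 (holo_ext _ _ fun z => by rw [hc z, map_zero])
  obtain ⟨⟨⟨u1, a1'⟩, hz1⟩, hz⟩ := hnz
  -- specialise
  let sp : MvPolynomial (Fin n ⊕ (Fin n ⊕ Fin n)) ℂ →+* MvPolynomial (Fin n) ℂ :=
    (aeval (Sum.elim (fun j => (MvPolynomial.X j : MvPolynomial (Fin n) ℂ))
      (Sum.elim (fun j => C (φ j a1')) (fun j => C (φ j (-a1'))))) :
      MvPolynomial (Fin n ⊕ (Fin n ⊕ Fin n)) ℂ →ₐ[ℂ] MvPolynomial (Fin n) ℂ).toRingHom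
  have hsp : ∀ (u : Fin n → ℂ) (hu : (u, a1') ∈ Ω), (eval (fun j => φ j u)).comp sp =
      ((evH (⟨(u, a1'), hu⟩ : Ω)).toRingHom).comp (aeval (Sum.elim X (Sum.elim Z Z'))).toRingHom := by
    intro u hu
    apply MvPolynomial.ringHom_ext
    · intro r
      simp only [RingHom.comp_apply, sp, AlgHom.toRingHom_eq_coe, RingHom.coe_coe]
      rw [algHom_C, algHom_C]; simp [MvPolynomial.algebraMap_eq]
    · intro i
      rcases i with j | j | j <;> simp [sp, hX, hZ, hZ']
  refine ⟨P.map sp, ?_, u1, ?_⟩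
  · intro h0
    apply hz
    have h1 : sp P.leadingCoeff = 0 := by
      have := congrArg (fun p => p.coeff P.natDegree) h0
      simpa using this
    have h2 := congrArg (fun g => g P.leadingCoeff) (hsp u1 hz1)
    simp only [RingHom.comp_apply, h1, map_zero] at h2
    exact h2.symm
  · have hcont : Continuous fun u : Fin n → ℂ => (u, a1') := by fun_prop
    filter_upwards [hcont.continuousAt.preimage_mem_nhds (ho.mem_nhds hz1)] with u hu
    have h1 := congrArg (evH (⟨(u, a1'), hu⟩ : Ω)) hP2
    rw [map_zero] at h1
    rw [ev, Polynomial.map_map, hsp u hu, Polynomial.eval_map]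
    have h2 := Polynomial.hom_eval₂ P (aeval (Sum.elim X (Sum.elim Z Z'))).toRingHom (evH (⟨(u, a1'), hu⟩ : Ω)).toRingHom f
    exact h2.symm.trans h1

lemma minimal_poly {n : ℕ} (φ : Fin n → (Fin n → ℂ) → ℂ) (θ : (Fin n → ℂ) → ℂ) (w : Fin n → ℂ)
    (hφ : ∀ j, AnalyticAt ℂ (φ j) w) (hd : Matrix.det (Matrix.of fun k p => pd (φ k) p w) ≠ 0)
    (hθ : AnalyticAt ℂ θ w) (V0 : Polynomial (MvPolynomial (Fin n) ℂ)) (hV0 : V0 ≠ 0)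
    (hV : ∀ᶠ u in 𝓝 w, ev V0 (fun j => φ j u) (θ u) = 0) :
    ∃ V : Polynomial (MvPolynomial (Fin n) ℂ), V ≠ 0 ∧
      (∀ᶠ u in 𝓝 w, ev V (fun j => φ j u) (θ u) = 0) ∧
      (∃ N : MvPolynomial (Fin n) ℂ, N ≠ 0 ∧ ∀ x t, eval x N ≠ 0 → ev V x t = 0 →
        ev V.derivative x t ≠ 0) ∧
      ∀ Q, (∃ᶠ u in 𝓝 w, ev Q (fun j => φ j u) (θ u) ≠ 0) → 
        ∃ N : MvPolynomial (Fin n) ℂ, N ≠ 0 ∧ ∀ x t, eval x N ≠ 0 → ev V x t = 0 → ev Q x t ≠ 0 := by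
  classical
  have hΩ : ∀ᶠ u in 𝓝 w, (∀ j, AnalyticAt ℂ (φ j) u) ∧ AnalyticAt ℂ θ u ∧
      ev V0 (fun j => φ j u) (θ u) = 0 := by
    have : ∀ᶠ u in 𝓝 w, ∀ j, AnalyticAt ℂ (φ j) u := by
      rw [eventually_all]
      exact fun j => (hφ j).eventually_analyticAt
    exact this.and (hθ.eventually_analyticAt.and hV)
  obtain ⟨ε, hε, hb⟩ := Metric.eventually_nhds_iff_ball.1 hΩ
  set Ω := Metric.ball w ε with hΩdef
  have ho : IsOpen Ω := Metric.isOpen_ball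
  have hmem : w ∈ Ω := Metric.mem_ball_self hε
  have hpc : IsPreconnected Ω := (convex_ball _ _).isPreconnected
  have hdom : IsDomain (holo Ω) := holo_domain ho hpc ⟨_, hmem⟩
  set X : Fin n → holo Ω := fun j => mkH (φ j) (fun u hu => (hb u hu).1 j) with hX
  set s : holo Ω := mkH θ (fun u hu => (hb u hu).2.1) with hs
  letI : Algebra (MvPolynomial (Fin n) ℂ) (holo Ω) := (aeval X).toRingHom.toAlgebra
  have hmap : ∀ P : MvPolynomial (Fin n) ℂ, algebraMap _ (holo Ω) P = aeval X P := fun P => rfl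
  have hev : ∀ (z : Ω) (Q : Polynomial (MvPolynomial (Fin n) ℂ)),
      evH z (Polynomial.aeval s Q) = ev Q (fun j => φ j z) (θ z) := by
    intro z Q
    rw [Polynomial.aeval_def]
    have h2 := Polynomial.hom_eval₂ Q (algebraMap _ (holo Ω)) (evH z).toRingHom s
    refine h2.trans ?_
    rw [ev, Polynomial.eval_map]
    congr 1
    apply RingHom.ext
    intro P
    exact evH_aeval z X P
  have hinj : FaithfulSMul (MvPolynomial (Fin n) ℂ) (holo Ω) := by
    rw [faithfulSMul_iff_algebraMap_injective, injective_iff_map_eq_zero]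
    intro P hP
    apply no_rel1 hφ hd P
    filter_upwards [ho.mem_nhds hmem] with u hu
    have := evH_aeval (⟨u, hu⟩ : Ω) X P
    rw [← hmap, hP, map_zero] at this
    exact this.symm
  have halg : IsAlgebraic (MvPolynomial (Fin n) ℂ) s := by
    refine ⟨V0, hV0, holo_ext _ _ fun z => ?_⟩
    rw [hev, map_zero]
    exact (hb z z.2).2.2
  have hchar : CharZero (MvPolynomial (Fin n) ℂ) := inferInstance
  obtain ⟨V, h1, h2, h3, h4⟩ := alg_good s halg
  have key : ∀ Q, Polynomial.aeval s Q ≠ 0 → ∃ N : MvPolynomial (Fin n) ℂ, N ≠ 0 ∧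
      ∀ x t, eval x N ≠ 0 → ev V x t = 0 → ev Q x t ≠ 0 := by
    intro Q hQ
    obtain ⟨A, B, N, hN, hAB⟩ := h4 Q hQ
    refine ⟨N, hN, fun x t hx hv hq => hx ?_⟩
    rw [← ev_C N x t, ← hAB, ev_add, ev_mul, ev_mul, hv, hq]
    simp
  refine ⟨V, h1, ?_, key _ h3, fun Q hQ => key Q ?_⟩
  · filter_upwards [ho.mem_nhds hmem] with u hu
    rw [← hev ⟨u, hu⟩, h2, map_zero]
  · intro h0
    apply hQ
    filter_upwards [ho.mem_nhds hmem] with u hu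
    rw [not_not, ← hev ⟨u, hu⟩, h0, map_zero]

/-- `F` is a quotient of entire functions with denominator nonvanishing where `H ≠ 0`. -/
def GoodFor {n : ℕ} (H F : (Fin n → ℂ) → ℂ) : Prop :=
  ∃ g h : (Fin n → ℂ) → ℂ, (∀ u, AnalyticAt ℂ g u) ∧ (∀ u, AnalyticAt ℂ h u) ∧
    ∀ u, H u ≠ 0 → h u ≠ 0 ∧ F u = g u / h u

lemma GoodFor.analyticAt {n : ℕ} {H F : (Fin n → ℂ) → ℂ} (hH : ∀ u, AnalyticAt ℂ H u)
    (h : GoodFor H F) {u : Fin n → ℂ} (hu : H u ≠ 0) : AnalyticAt ℂ F u := by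
  obtain ⟨g, k, hg, hk, h⟩ := h
  refine ((hg u).div (hk u) (h u hu).1).congr ?_
  filter_upwards [(hH u).continuousAt.eventually_ne hu] with z hz
  exact ((h z hz).2).symm

lemma GoodFor.cont {n : ℕ} {H F : (Fin n → ℂ) → ℂ} 
    (h : GoodFor H F) {U : Set ℂ} (hU : IsPreconnected U) {u : ℂ → Fin n → ℂ}
    (hu : AnalyticOnNhd ℂ u U) {τ : ℂ → ℂ} (hτ : AnalyticOnNhd ℂ τ U) {s1 : ℂ} (hs1 : s1 ∈ U)
    (he : ∀ᶠ s in 𝓝[≠] s1, H (u s) ≠ 0 ∧ F (u s) = τ s) : ∀ s ∈ U, H (u s) ≠ 0 → F (u s) = τ s := by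
  obtain ⟨g, k, hg, hk, h⟩ := h
  have h1 : AnalyticOnNhd ℂ (fun s => g (u s)) U := fun s hs => (hg _).fun_comp (hu s hs)
  have h2 : AnalyticOnNhd ℂ (fun s => τ s * k (u s)) U := fun s hs =>
    (hτ s hs).fun_mul ((hk _).fun_comp (hu s hs))
  have h3 := h1.eqOn_of_preconnected_of_frequently_eq h2 hU hs1 (by
    apply Eventually.frequently
    filter_upwards [he] with s hs
    obtain ⟨a, b⟩ := h _ hs.1
    rw [← hs.2, b, div_mul_cancel₀ _ a])
  intro s hs hne
  obtain ⟨a, b⟩ := h _ hne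
  rw [b, div_eq_iff a]
  exact h3 hs

/-- The data needed for the continuation argument. -/
structure Core (n : ℕ) where
  φ : Fin n → (Fin n → ℂ) → ℂ
  θ : (Fin n → ℂ) → ℂ
  f : (Fin n → ℂ) → ℂ
  H : (Fin n → ℂ) → ℂ
  V : Polynomial (MvPolynomial (Fin n) ℂ)
  W : Polynomial (MvPolynomial (Fin n) ℂ)
  β : Polynomial (MvPolynomial (Fin n) ℂ)
  M : Fin n → Fin n → Polynomial (MvPolynomial (Fin n) ℂ)
  N : MvPolynomial (Fin n) ℂ
  H_an : ∀ u, AnalyticAt ℂ H u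
  gφ : ∀ j, GoodFor H (φ j)
  gθ : GoodFor H θ
  gf : GoodFor H f
  Vlc : ∀ x, eval x N ≠ 0 → eval x V.leadingCoeff ≠ 0
  Wlc : ∀ x, eval x N ≠ 0 → eval x W.leadingCoeff ≠ 0
  Vsep : ∀ x, eval x N ≠ 0 → ∀ t, ev V x t = 0 → ev V.derivative x t ≠ 0
  Wsep : ∀ x, eval x N ≠ 0 → ∀ t, ev W x t = 0 → ev W.derivative x t ≠ 0
  hβ : ∀ x, eval x N ≠ 0 → ∀ t, ev V x t = 0 → ev β x t ≠ 0
  hV : ∀ u, H u ≠ 0 → ev V (fun j => φ j u) (θ u) = 0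
  hW : ∀ u, H u ≠ 0 → ev W (fun j => φ j u) (f u) = 0
  hN : ∀ u, H u ≠ 0 → eval (fun j => φ j u) N ≠ 0
  hM : ∀ u, H u ≠ 0 → ∀ i p, ∑ k, ev (M i k) (fun j => φ j u) (θ u) * pd (φ k) p u =
    if i = p then ev β (fun j => φ j u) (θ u) else 0
  hdet : ∀ u, H u ≠ 0 → Matrix.det (Matrix.of fun k p => pd (φ k) p u) ≠ 0
  hper : ∀ p d, H p ≠ 0 → (∀ᶠ z in 𝓝 p, ∀ j, φ j (z + d) = φ j z) →
    ∀ u, H u ≠ 0 → H (u + d) ≠ 0 → f (u + d) = f u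

namespace Core
variable {n : ℕ} (c : Core n)

lemma fderiv_pd {F : (Fin n → ℂ) → ℂ} {u : Fin n → ℂ} (v : Fin n → ℂ) :
    fderiv ℂ F u v = ∑ p, pd F p u * v p := by
  conv_lhs => rw [pi_eq_sum_univ' v]
  rw [map_sum]
  refine Finset.sum_congr rfl fun p _ => ?_
  rw [map_smul, smul_eq_mul, mul_comm, pd]

/-- chain rule consequence -/
lemma deriv_formula {u : ℂ → Fin n → ℂ} {s : ℂ} {u' w x : Fin n → ℂ} {t : ℂ} (hu : HasDerivAt u u' s)
    (hH : c.H (u s) ≠ 0) (hx : (fun j => c.φ j (u s)) = x) (ht : c.θ (u s) = t)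
    (hd : ∀ k, HasDerivAt (fun s => c.φ k (u s)) (w k) s) (i : Fin n) :
    ev c.β x t * u' i = ∑ k, ev (c.M i k) x t * w k := by
  have h1 : ∀ k, w k = ∑ p, pd (c.φ k) p (u s) * u' p := by
    intro k
    have h2 := ((c.gφ k).analyticAt c.H_an hH).differentiableAt.hasFDerivAt.comp_hasDerivAt s hu
    rw [← fderiv_pd]
    exact (hd k).unique h2
  have h3 := c.hM (u s) hH i
  rw [hx, ht] at h3
  calc ev c.β x t * u' i = ∑ p, (if i = p then ev c.β x t else 0) * u' p := by
        simp
    _ = ∑ p, (∑ k, ev (c.M i k) x t * pd (c.φ k) p (u s)) * u' p := by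
        simp_rw [h3]
    _ = _ := by
        simp_rw [h1, Finset.sum_mul, Finset.mul_sum]
        rw [Finset.sum_comm]
        simp_rw [mul_assoc]

lemma branch_unique {X : Type*} {l : Filter X} {Z : Finset ℂ} {V : Polynomial (MvPolynomial (Fin n) ℂ)}
    {τ : ℂ → (Fin n → ℂ) → ℂ} {x1 : Fin n → ℂ} 
    (h1 : ∀ r ∈ Z, AnalyticAt ℂ (τ r) x1) 
    (h2 : ∀ᶠ x in 𝓝 x1, (∀ t, ev V x t = 0 ↔ ∃ r ∈ Z, τ r x = t) ∧ Set.InjOn (fun r => τ r x) Z)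
    {x : X → Fin n → ℂ} {t : X → ℂ} (hx : Tendsto x l (𝓝 x1)) {t1 : ℂ} (ht : Tendsto t l (𝓝 t1))
    (hV : ∀ᶠ s in l, ev V (x s) (t s) = 0) [l.NeBot] :
    ∃ r ∈ Z, τ r x1 = t1 ∧ ∀ᶠ s in l, t s = τ r (x s) := by
  have hV1 : ev V x1 t1 = 0 := by
    have hc : ContinuousAt (fun z : (Fin n → ℂ) × ℂ => ev V z.1 z.2) (x1, t1) :=
      (ev_analyticAt V (fun j => (coord_ana j _).fun_comp analyticAt_fst) analyticAt_snd).continuousAt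
    have : Tendsto (fun s => ev V (x s) (t s)) l (𝓝 (ev V x1 t1)) :=
      hc.tendsto.comp (hx.prodMk_nhds ht)
    refine tendsto_nhds_unique (this.congr' ?_) tendsto_const_nhds
    exact hV
  obtain ⟨r, hr, hrt⟩ := (h2.self_of_nhds.1 t1).1 hV1
  refine ⟨r, hr, hrt, ?_⟩
  have h3 : ∀ᶠ s in l, ∀ r' ∈ Z, r' ≠ r → τ r' (x s) ≠ t s := by
    rw [eventually_all_finset]
    intro r' hr'
    by_cases h : r' = r
    · exact Eventually.of_forall fun _ h' => absurd h h'
    · have hne : τ r' x1 - t1 ≠ 0 := by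
        rw [← hrt, sub_ne_zero]
        exact fun h' => h (h2.self_of_nhds.2 hr' hr h')
      have := (((h1 r' hr').continuousAt.tendsto.comp hx).sub ht).eventually_ne hne
      filter_upwards [this] with s hs _
      simpa [sub_ne_zero] using hs
  filter_upwards [hV, hx.eventually h2, h3] with s hs1 hs2 hs3
  obtain ⟨r', hr', h⟩ := (hs2.1 _).1 hs1
  by_cases hrr : r' = r
  · rw [← hrr, h]
  · exact absurd h (hs3 r' hr' hrr)

lemma inverse_near {p : Fin n → ℂ} (hp : c.H p ≠ 0) : ∃ ι : (Fin n → ℂ) → (Fin n → ℂ),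
    AnalyticAt ℂ ι (fun j => c.φ j p) ∧ ι (fun j => c.φ j p) = p ∧
      (∀ᶠ x in 𝓝 (fun j => c.φ j p), (fun j => c.φ j (ι x)) = x) ∧
      (∀ᶠ u in 𝓝 p, ι (fun j => c.φ j u) = u) :=
  local_inverse c.φ p (fun j => (c.gφ j).analyticAt c.H_an hp) (c.hdet p hp)

end Core

namespace Core
variable {n : ℕ} (c : Core n)

lemma branches_at {x : Fin n → ℂ} (hx : eval x c.N ≠ 0) : ∃ (Z : Finset ℂ) (τ : ℂ → (Fin n → ℂ) → ℂ),
    (∀ r ∈ Z, AnalyticAt ℂ (τ r) x ∧ τ r x = r) ∧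
    ∀ᶠ x in 𝓝 x, (∀ t, ev c.V x t = 0 ↔ ∃ r ∈ Z, τ r x = t) ∧ Set.InjOn (fun r => τ r x) Z :=
  branches c.V x (c.Vlc x hx) (c.Vsep x hx)

lemma inv_deriv {ι : (Fin n → ℂ) → (Fin n → ℂ)} {x w : Fin n → ℂ} (hι : AnalyticAt ℂ ι x)
    (hH : c.H (ι x) ≠ 0) (hinv : ∀ᶠ z in 𝓝 x, (fun j => c.φ j (ι z)) = z) (i : Fin n) :
    ev c.β x (c.θ (ι x)) * fderiv ℂ ι x w i = ∑ k, ev (c.M i k) x (c.θ (ι x)) * w k := by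
  have hline : HasDerivAt (fun s : ℂ => x + s • w) w 0 := by
    simpa using ((hasDerivAt_id (0:ℂ)).smul_const w).const_add x
  have hx0 : x + (0:ℂ) • w = x := by simp
  have h1 : HasDerivAt (fun s : ℂ => ι (x + s • w)) (fderiv ℂ ι x w) 0 := by
    exact hι.differentiableAt.hasFDerivAt.comp_hasDerivAt_of_eq (0:ℂ) hline hx0.symm
  refine c.deriv_formula (s := 0) h1 (by simpa using hH) ?_ (by simp) ?_ i
  · simpa using hinv.self_of_nhds
  · intro k
    have h2 : HasDerivAt (fun s : ℂ => (x + s • w) k) (w k) 0 := (hasDerivAt_pi.1 hline) k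
    refine h2.congr_of_eventuallyEq ?_
    have h3 : Tendsto (fun s : ℂ => x + s • w) (𝓝 0) (𝓝 x) := by
      have := hline.continuousAt.tendsto
      simpa using this
    filter_upwards [h3.eventually hinv] with s hs
    exact congrFun hs k

lemma period {p q : Fin n → ℂ} (hp : c.H p ≠ 0) (hq : c.H q ≠ 0)
    (h1 : (fun j => c.φ j p) = fun j => c.φ j q) (h2 : c.θ p = c.θ q) :
    ∀ᶠ z in 𝓝 p, ∀ j, c.φ j (z + (q - p)) = c.φ j z := by
  obtain ⟨ι, a1, a2, a3, a4⟩ := c.inverse_near hp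
  obtain ⟨ι', b1, b2, b3, b4⟩ := c.inverse_near hq
  rw [← h1] at b1 b2 b3
  set y := (fun j => c.φ j p) with hy
  have hN : eval y c.N ≠ 0 := c.hN p hp
  obtain ⟨Z, τ, z1, z2⟩ := c.branches_at hN
  have hHι : ∀ᶠ x in 𝓝 y, c.H (ι x) ≠ 0 := by
    have := ((c.H_an (ι y)).continuousAt.comp a1.continuousAt)
    exact this.eventually_ne (by simpa [a2] using hp)
  have hHι' : ∀ᶠ x in 𝓝 y, c.H (ι' x) ≠ 0 := by
    have := ((c.H_an (ι' y)).continuousAt.comp b1.continuousAt)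
    exact this.eventually_ne (by simpa [b2] using hq)
  have t1 : Tendsto (fun x => c.θ (ι x)) (𝓝 y) (𝓝 (c.θ p)) := by
    have : ContinuousAt c.θ (ι y) := by rw [a2]; exact (c.gθ.analyticAt c.H_an hp).continuousAt
    have := (this.comp a1.continuousAt).tendsto
    simpa [a2, Function.comp_def] using this
  have t2 : Tendsto (fun x => c.θ (ι' x)) (𝓝 y) (𝓝 (c.θ p)) := by
    have : ContinuousAt c.θ (ι' y) := by rw [b2]; exact (c.gθ.analyticAt c.H_an hq).continuousAt
    have := (this.comp b1.continuousAt).tendsto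
    rw [h2]
    simpa [b2, Function.comp_def] using this
  obtain ⟨r, hr, hr1, hr2⟩ := branch_unique (fun r hr => (z1 r hr).1) z2 (x := fun x => x) tendsto_id t1
    (by filter_upwards [hHι, a3] with x hx hx'
        have := c.hV _ hx
        rwa [hx'] at this)
  obtain ⟨r', hr', hr1', hr2'⟩ := branch_unique (fun r hr => (z1 r hr).1) z2 (x := fun x => x) tendsto_id t2
    (by filter_upwards [hHι', b3] with x hx hx'
        have := c.hV _ hx
        rwa [hx'] at this)
  have hrr : r' = r := z2.self_of_nhds.2 hr' hr (by simp only; rw [hr1, hr1'])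
  subst hrr
  have key : ∀ᶠ x in 𝓝 y, DifferentiableAt ℂ (fun x => ι' x - ι x) x ∧ fderiv ℂ (fun x => ι' x - ι x) x = 0 := by
    filter_upwards [hHι, hHι', a1.eventually_analyticAt, b1.eventually_analyticAt, hr2, hr2',
      a3.eventually_nhds, b3.eventually_nhds] with x k1 k2 k3 k4 k5 k6 k7 k8
    refine ⟨k4.differentiableAt.sub k3.differentiableAt, ?_⟩
    rw [fderiv_fun_sub k4.differentiableAt k3.differentiableAt, sub_eq_zero]
    ext w : 1
    funext i
    have e1 := c.inv_deriv (w := w) k3 k1 k7 i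
    have e2 := c.inv_deriv (w := w) k4 k2 k8 i
    have hb : ev c.β x (c.θ (ι x)) ≠ 0 := by
      have m1 := c.hN _ k1
      have m2 := c.hV _ k1
      rw [k7.self_of_nhds] at m1 m2
      exact c.hβ x m1 _ m2
    rw [k6, ← k5, ← e1] at e2
    exact mul_left_cancel₀ hb e2
  obtain ⟨ε, hε, hb⟩ := Metric.eventually_nhds_iff_ball.1 key
  have hconst : ∀ x ∈ Metric.ball y ε, ι' x - ι x = q - p := by
    intro x hx
    have := Metric.isOpen_ball.is_const_of_fderiv_eq_zero (𝕜 := ℂ) (f := fun x => ι' x - ι x)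
      (convex_ball y ε).isPreconnected (fun z hz => (hb z hz).1.differentiableWithinAt)
      (fun z hz => (hb z hz).2) hx (Metric.mem_ball_self hε)
    simpa [a2, b2] using this
  have hφc : Tendsto (fun z => fun j => c.φ j z) (𝓝 p) (𝓝 y) := by
    rw [hy]
    exact tendsto_pi_nhds.2 fun j => ((c.gφ j).analyticAt c.H_an hp).continuousAt.tendsto
  filter_upwards [a4, hφc.eventually (Metric.ball_mem_nhds y hε), hφc.eventually b3] with z q1 q2 q3 j
  have q4 := hconst _ q2
  rw [q1] at q4
  rw [← q4, add_sub_cancel]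
  exact congrFun q3 j

end Core

/-- Branches of the zero set of a polynomial near a point. -/
def Br {n : ℕ} (V : Polynomial (MvPolynomial (Fin n) ℂ)) (Z : Finset ℂ) (τ : ℂ → (Fin n → ℂ) → ℂ)
    (x : Fin n → ℂ) : Prop :=
  (∀ r ∈ Z, AnalyticAt ℂ (τ r) x) ∧
    ∀ᶠ x in 𝓝 x, (∀ t, ev V x t = 0 ↔ ∃ r ∈ Z, τ r x = t) ∧ Set.InjOn (fun r => τ r x) Z

lemma Br.eventually {n : ℕ} {V : Polynomial (MvPolynomial (Fin n) ℂ)} {Z : Finset ℂ}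
    {τ : ℂ → (Fin n → ℂ) → ℂ} {x : Fin n → ℂ} (h : Br V Z τ x) : ∀ᶠ z in 𝓝 x, Br V Z τ z := by
  have h1 : ∀ᶠ z in 𝓝 x, ∀ r ∈ Z, AnalyticAt ℂ (τ r) z := by
    rw [eventually_all_finset]
    exact fun r hr => (h.1 r hr).eventually_analyticAt
  filter_upwards [h1, h.2.eventually_nhds] with z a b using ⟨a, b⟩

lemma locally_const {E : Type*} [NormedAddCommGroup E] [NormedSpace ℂ E] {g : ℂ → E} {s : ℂ}
    (hg : ∀ᶠ z in 𝓝 s, DifferentiableAt ℂ g z) (hd : ContinuousAt (deriv g) s)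
    (h : ∀ᶠ z in 𝓝[≠] s, deriv g z = 0) : ∀ᶠ z in 𝓝 s, g z = g s := by
  have h1 : deriv g =ᶠ[𝓝 s] fun _ => 0 :=
    (hd.eventuallyEq_nhds_iff_eventuallyEq_nhdsNE continuousAt_const).1 h
  obtain ⟨ε, hε, hb⟩ := Metric.eventually_nhds_iff_ball.1 (hg.and h1)
  filter_upwards [Metric.ball_mem_nhds s hε] with z hz
  exact Metric.isOpen_ball.is_const_of_deriv_eq_zero (𝕜 := ℂ) (convex_ball s ε).isPreconnected
    (fun z hz => (hb z hz).1.differentiableWithinAt) (fun z hz => (hb z hz).2) hz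
    (Metric.mem_ball_self hε)

lemma line_ana {n : ℕ} (x0 w : Fin n → ℂ) (s : ℂ) : AnalyticAt ℂ (fun s : ℂ => x0 + s • w) s := by
  fun_prop

lemma line_deriv {n : ℕ} (x0 w : Fin n → ℂ) (s : ℂ) (k : Fin n) :
    HasDerivAt (fun s : ℂ => (x0 + s • w) k) (w k) s := by
  have hline : HasDerivAt (fun s : ℂ => x0 + s • w) w s := by
    simpa using ((hasDerivAt_id s).smul_const w).const_add x0
  exact (hasDerivAt_pi.1 hline) k

namespace Core
variable {n : ℕ} (c : Core n)

/-- The set of values of `(θ, f)` at solutions of `φ(u) = x` along a line. -/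
def S (x0 w : Fin n → ℂ) (s1 : ℂ) : Set (ℂ × ℂ) :=
  {q | ∃ u : ℂ → Fin n → ℂ, AnalyticAt ℂ u s1 ∧
    (∀ᶠ s in 𝓝[≠] s1, c.H (u s) ≠ 0 ∧ (fun j => c.φ j (u s)) = x0 + s • w) ∧
    Tendsto (fun s => c.θ (u s)) (𝓝[≠] s1) (𝓝 q.1) ∧
    Tendsto (fun s => c.f (u s)) (𝓝[≠] s1) (𝓝 q.2)}

/-- All good things at `x`. -/
def Nice (ZV : Finset ℂ) (τ : ℂ → (Fin n → ℂ) → ℂ) (ZW : Finset ℂ) (μ : ℂ → (Fin n → ℂ) → ℂ)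
    (x : Fin n → ℂ) : Prop :=
  eval x c.N ≠ 0 ∧ Br c.V ZV τ x ∧ Br c.W ZW μ x

lemma Nice.eventually {c : Core n} {ZV : Finset ℂ} {τ : ℂ → (Fin n → ℂ) → ℂ} {ZW : Finset ℂ}
    {μ : ℂ → (Fin n → ℂ) → ℂ} {x : Fin n → ℂ} (h : c.Nice ZV τ ZW μ x) :
    ∀ᶠ z in 𝓝 x, c.Nice ZV τ ZW μ z := by
  filter_upwards [(mvpoly_ent c.N x).continuousAt.eventually_ne h.1, h.2.1.eventually,
    h.2.2.eventually] with z a b d using ⟨a, b, d⟩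

lemma exists_nice {x : Fin n → ℂ} (hx : eval x c.N ≠ 0) : ∃ ZV τ ZW μ, c.Nice ZV τ ZW μ x := by
  obtain ⟨ZV, τ, a, b⟩ := branches c.V x (c.Vlc x hx) (c.Vsep x hx)
  obtain ⟨ZW, μ, a', b'⟩ := branches c.W x (c.Wlc x hx) (c.Wsep x hx)
  exact ⟨ZV, τ, ZW, μ, hx, ⟨fun r hr => (a r hr).1, b⟩, ⟨fun r hr => (a' r hr).1, b'⟩⟩

lemma line_eventually {P : (Fin n → ℂ) → Prop} {x0 w : Fin n → ℂ} {s : ℂ}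
    (h : ∀ᶠ z in 𝓝 (x0 + s • w), P z) : ∀ᶠ z in 𝓝 s, P (x0 + z • w) :=
  (line_ana x0 w s).continuousAt.tendsto.eventually h

/-- Solutions on a ball -/
def Pred (ZV : Finset ℂ) (τ : ℂ → (Fin n → ℂ) → ℂ) (ZW : Finset ℂ) (μ : ℂ → (Fin n → ℂ) → ℂ)
    (x0 w : Fin n → ℂ) (s1 : ℂ) (ρ : ℝ) (K : ℂ → ℂ → Fin n → ℂ) (p : ℂ × ℂ) : Prop :=
  p.1 ∈ ZV ∧ p.2 ∈ ZW ∧ ∃ d : Fin n → ℂ, (∃ s ∈ Metric.ball s1 ρ, c.H (K p.1 s + d) ≠ 0) ∧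
    ∀ s ∈ Metric.ball s1 ρ, c.H (K p.1 s + d) ≠ 0 → (fun j => c.φ j (K p.1 s + d)) = x0 + s • w ∧
      c.θ (K p.1 s + d) = τ p.1 (x0 + s • w) ∧ c.f (K p.1 s + d) = μ p.2 (x0 + s • w)

/-- velocity -/
noncomputable def κ (x0 w : Fin n → ℂ) (τ : (Fin n → ℂ) → ℂ) (s : ℂ) (i : Fin n) : ℂ :=
  (∑ k, ev (c.M i k) (x0 + s • w) (τ (x0 + s • w)) * w k) / ev c.β (x0 + s • w) (τ (x0 + s • w))

lemma κ_ana {x0 w : Fin n → ℂ} {τ : (Fin n → ℂ) → ℂ} {s : ℂ} (hN : eval (x0 + s • w) c.N ≠ 0)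
    (hτ : AnalyticAt ℂ τ (x0 + s • w)) (hV : ev c.V (x0 + s • w) (τ (x0 + s • w)) = 0) :
    AnalyticAt ℂ (c.κ x0 w τ) s := by
  rw [analyticAt_pi_iff]
  intro i
  have hc : ∀ P : Polynomial (MvPolynomial (Fin n) ℂ),
      AnalyticAt ℂ (fun s : ℂ => ev P (x0 + s • w) (τ (x0 + s • w))) s := fun P =>
    ev_analyticAt P (fun j => (coord_ana j _).fun_comp (line_ana x0 w s))
      (AnalyticAt.fun_comp (g := τ) (f := fun s : ℂ => x0 + s • w) hτ (line_ana x0 w s))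
  refine AnalyticAt.fun_div ?_ (hc _) (c.hβ _ hN _ hV)
  exact Finset.analyticAt_fun_sum _ fun k _ => (hc _).fun_mul analyticAt_const

lemma H_ne_eventually {U : Set ℂ} (hU : IsPreconnected U) {u : ℂ → Fin n → ℂ}
    (hu : AnalyticOnNhd ℂ u U) (h : ∃ s ∈ U, c.H (u s) ≠ 0) {s : ℂ} (hs : s ∈ U) :
    ∀ᶠ z in 𝓝[≠] s, c.H (u z) ≠ 0 := by
  by_contra hcon
  rw [not_eventually] at hcon
  obtain ⟨s', hs', hne⟩ := h
  have h1 : AnalyticOnNhd ℂ (fun s => c.H (u s)) U := fun s hs => (c.H_an _).fun_comp (hu s hs)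
  exact hne (h1.eqOn_zero_of_preconnected_of_frequently_eq_zero hU hs
    (hcon.mono fun z hz => not_not.1 hz) hs')

end Core

namespace Core
variable {n : ℕ} (c : Core n)

lemma Pred.mem {c : Core n} {ZV : Finset ℂ} {τ : ℂ → (Fin n → ℂ) → ℂ} {ZW : Finset ℂ} {μ : ℂ → (Fin n → ℂ) → ℂ}
    {x0 w : Fin n → ℂ} {s1 : ℂ} {ρ : ℝ} {K : ℂ → ℂ → Fin n → ℂ} {p : ℂ × ℂ}
    (hb : ∀ s ∈ Metric.ball s1 ρ, c.Nice ZV τ ZW μ (x0 + s • w))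
    (hK : ∀ r ∈ ZV, ∀ s ∈ Metric.ball s1 ρ, AnalyticAt ℂ (K r) s)
    (h : c.Pred ZV τ ZW μ x0 w s1 ρ K p) {s : ℂ} (hs : s ∈ Metric.ball s1 ρ) :
    (τ p.1 (x0 + s • w), μ p.2 (x0 + s • w)) ∈ c.S x0 w s := by
  obtain ⟨h1, h2, d, h3, h4⟩ := h
  have hu : AnalyticOnNhd ℂ (fun s => K p.1 s + d) (Metric.ball s1 ρ) := fun s hs =>
    (hK _ h1 s hs).fun_add analyticAt_const
  have hne := c.H_ne_eventually (convex_ball s1 ρ).isPreconnected hu h3 hs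
  have hball : ∀ᶠ z in 𝓝[≠] s, z ∈ Metric.ball s1 ρ :=
    nhdsWithin_le_nhds (Metric.isOpen_ball.mem_nhds hs)
  have hall : ∀ᶠ z in 𝓝[≠] s, c.H (K p.1 z + d) ≠ 0 ∧ (fun j => c.φ j (K p.1 z + d)) = x0 + z • w ∧
      c.θ (K p.1 z + d) = τ p.1 (x0 + z • w) ∧ c.f (K p.1 z + d) = μ p.2 (x0 + z • w) := by
    filter_upwards [hne, hball] with z a b using ⟨a, h4 z b a⟩
  refine ⟨fun s => K p.1 s + d, hu s hs, ?_, ?_, ?_⟩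
  · filter_upwards [hall] with z hz using ⟨hz.1, hz.2.1⟩
  · have hc : ContinuousAt (fun z : ℂ => τ p.1 (x0 + z • w)) s :=
      ContinuousAt.comp (g := τ p.1) (f := fun z : ℂ => x0 + z • w)
        ((hb s hs).2.1.1 _ h1).continuousAt (line_ana x0 w s).continuousAt
    refine (hc.tendsto.mono_left nhdsWithin_le_nhds).congr' ?_
    filter_upwards [hall] with z hz using hz.2.2.1.symm
  · have hc : ContinuousAt (fun z : ℂ => μ p.2 (x0 + z • w)) s :=
      ContinuousAt.comp (g := μ p.2) (f := fun z : ℂ => x0 + z • w)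
        ((hb s hs).2.2.1 _ h2).continuousAt (line_ana x0 w s).continuousAt
    refine (hc.tendsto.mono_left nhdsWithin_le_nhds).congr' ?_
    filter_upwards [hall] with z hz using hz.2.2.2.symm

lemma Pred.of_mem {c : Core n} {ZV : Finset ℂ} {τ : ℂ → (Fin n → ℂ) → ℂ} {ZW : Finset ℂ} {μ : ℂ → (Fin n → ℂ) → ℂ}
    {x0 w : Fin n → ℂ} {s1 : ℂ} {ρ : ℝ} {K : ℂ → ℂ → Fin n → ℂ} 
    (hb : ∀ s ∈ Metric.ball s1 ρ, c.Nice ZV τ ZW μ (x0 + s • w))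
    (hK : ∀ r ∈ ZV, ∀ s ∈ Metric.ball s1 ρ, HasDerivAt (K r) (c.κ x0 w (τ r) s) s)
    (hKa : ∀ r ∈ ZV, ∀ s ∈ Metric.ball s1 ρ, AnalyticAt ℂ (K r) s)
    {s : ℂ} (hs : s ∈ Metric.ball s1 ρ) {q : ℂ × ℂ} (hq : q ∈ c.S x0 w s) :
    ∃ p, c.Pred ZV τ ZW μ x0 w s1 ρ K p ∧ (τ p.1 (x0 + s • w), μ p.2 (x0 + s • w)) = q := by
  obtain ⟨u, hu, h1, h2, h3⟩ := hq
  have hx : Tendsto (fun z : ℂ => x0 + z • w) (𝓝[≠] s) (𝓝 (x0 + s • w)) :=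
    (line_ana x0 w s).continuousAt.tendsto.mono_left nhdsWithin_le_nhds
  obtain ⟨r, hr, hr1, hr2⟩ := branch_unique (hb s hs).2.1.1 (hb s hs).2.1.2 hx h2 (by
    filter_upwards [h1] with z hz
    have := c.hV _ hz.1
    rwa [hz.2] at this)
  obtain ⟨r', hr', hr1', hr2'⟩ := branch_unique (hb s hs).2.2.1 (hb s hs).2.2.2 hx h3 (by
    filter_upwards [h1] with z hz
    have := c.hW _ hz.1
    rwa [hz.2] at this)
  have hball : ∀ᶠ z in 𝓝 s, z ∈ Metric.ball s1 ρ := Metric.isOpen_ball.mem_nhds hs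
  have hda : AnalyticAt ℂ (fun z => u z - K r z) s := hu.fun_sub (hKa r hr s hs)
  have hconst : ∀ᶠ z in 𝓝 s, u z - K r z = u s - K r s := by
    refine locally_const (g := fun z => u z - K r z) ?_ hda.deriv.continuousAt ?_
    · filter_upwards [hda.eventually_analyticAt] with z hz using hz.differentiableAt
    · have hev : ∀ᶠ z in 𝓝[≠] s, ∀ᶠ y in 𝓝 z, (fun j => c.φ j (u y)) = x0 + y • w := by
        have := eventually_eventually_nhdsWithin.2 h1
        filter_upwards [this, self_mem_nhdsWithin] with z hz hzs
        have hz' := hz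
        rw [IsOpen.nhdsWithin_eq isOpen_compl_singleton hzs] at hz'
        exact hz'.mono fun y hy => hy.2
      filter_upwards [h1, hr2, hev, nhdsWithin_le_nhds hball,
        nhdsWithin_le_nhds hu.eventually_analyticAt] with z k1 k2 k3 k4 k5
      have hud := k5.differentiableAt.hasDerivAt
      have hkd := hK r hr z k4
      rw [(hud.fun_sub hkd).deriv, sub_eq_zero]
      funext i
      have hf := c.deriv_formula (w := w) hud k1.1 k1.2 k2 (fun k => by
        refine (line_deriv x0 w z k).congr_of_eventuallyEq ?_
        filter_upwards [k3] with y hy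
        exact congrFun hy k) i
      have hVz := c.hV _ k1.1
      rw [k1.2, k2] at hVz
      rw [κ, eq_div_iff (c.hβ _ (hb z k4).1 _ hVz), ← hf, mul_comm]
  have huK : ∀ᶠ z in 𝓝 s, u z = K r z + (u s - K r s) := by
    filter_upwards [hconst] with z hz
    rw [← hz]; abel
  set d := u s - K r s with hd
  have hnear : ∀ᶠ z in 𝓝[≠] s, u z = K r z + d := nhdsWithin_le_nhds huK
  have hball2 : ∀ᶠ z in 𝓝[≠] s, z ∈ Metric.ball s1 ρ := nhdsWithin_le_nhds hball
  have hua : AnalyticOnNhd ℂ (fun s => K r s + d) (Metric.ball s1 ρ) := fun s hs =>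
    (hKa _ hr s hs).fun_add analyticAt_const
  have hpc := (convex_ball s1 ρ).isPreconnected
  refine ⟨(r, r'), ⟨hr, hr', d, ?_, ?_⟩, by simp [hr1, hr1']⟩
  · obtain ⟨z, a, b, e⟩ := (h1.and (hnear.and hball2)).exists
    refine ⟨z, e, ?_⟩
    simp only
    rw [← b]; exact a.1
  · intro z hz hne
    refine ⟨?_, ?_, ?_⟩
    · funext j
      refine (c.gφ j).cont (u := fun s => K r s + d) (τ := fun s => (x0 + s • w) j) hpc hua
        (fun s _ => (coord_ana j _).fun_comp (line_ana x0 w s)) hs ?_ z hz hne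
      filter_upwards [h1, hnear] with y a b
      rw [← b]; exact ⟨a.1, congrFun a.2 j⟩
    · refine c.gθ.cont (u := fun s => K r s + d) (τ := fun s => τ r (x0 + s • w)) hpc hua
        (fun s hs => AnalyticAt.fun_comp (g := τ r) (f := fun s : ℂ => x0 + s • w)
          ((hb s hs).2.1.1 r hr) (line_ana x0 w s)) hs ?_ z hz hne
      filter_upwards [h1, hnear, hr2] with y a b e
      rw [← b]; exact ⟨a.1, e⟩
    · refine c.gf.cont (u := fun s => K r s + d) (τ := fun s => μ r' (x0 + s • w)) hpc hua
        (fun s hs => AnalyticAt.fun_comp (g := μ r') (f := fun s : ℂ => x0 + s • w)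
          ((hb s hs).2.2.1 r' hr') (line_ana x0 w s)) hs ?_ z hz hne
      filter_upwards [h1, hnear, hr2'] with y a b e
      rw [← b]; exact ⟨a.1, e⟩

lemma Pred.inj {c : Core n} {ZV : Finset ℂ} {τ : ℂ → (Fin n → ℂ) → ℂ} {ZW : Finset ℂ} {μ : ℂ → (Fin n → ℂ) → ℂ}
    {x0 w : Fin n → ℂ} {s1 : ℂ} {ρ : ℝ} (hρ : 0 < ρ) {K : ℂ → ℂ → Fin n → ℂ} 
    (hb : ∀ s ∈ Metric.ball s1 ρ, c.Nice ZV τ ZW μ (x0 + s • w))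
    (hKa : ∀ r ∈ ZV, ∀ s ∈ Metric.ball s1 ρ, AnalyticAt ℂ (K r) s) {p q : ℂ × ℂ}
    (hp : c.Pred ZV τ ZW μ x0 w s1 ρ K p) (hq : c.Pred ZV τ ZW μ x0 w s1 ρ K q) (hpq : p.1 = q.1) :
    p = q := by
  obtain ⟨r, r1⟩ := p
  obtain ⟨r', r2⟩ := q
  simp only at hpq
  subst hpq
  obtain ⟨hr, hr1, d, h1, h2⟩ := hp
  obtain ⟨_, hr2, d', h1', h2'⟩ := hq
  simp only at *
  have hs := Metric.mem_ball_self (x := s1) hρ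
  have hpc := (convex_ball s1 ρ).isPreconnected
  have e1 := c.H_ne_eventually hpc (u := fun s => K r s + d)
    (fun s hs => (hKa _ hr s hs).fun_add analyticAt_const) h1 hs
  have e2 := c.H_ne_eventually hpc (u := fun s => K r s + d')
    (fun s hs => (hKa _ hr s hs).fun_add analyticAt_const) h1' hs
  have e3 : ∀ᶠ z in 𝓝[≠] s1, z ∈ Metric.ball s1 ρ :=
    nhdsWithin_le_nhds (Metric.isOpen_ball.mem_nhds hs)
  obtain ⟨z, z1, z2, z3⟩ := (e1.and (e2.and e3)).exists
  obtain ⟨a1, a2, a3⟩ := h2 z z3 z1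
  obtain ⟨b1, b2, b3⟩ := h2' z z3 z2
  have hper := c.period z1 z2 (a1.trans b1.symm) (a2.trans b2.symm)
  have hadd : K r z + d + (K r z + d' - (K r z + d)) = K r z + d' := by abel
  have := c.hper _ _ z1 hper _ z1 (by rw [hadd]; exact z2)
  rw [hadd, a3, b3] at this
  have := (hb z z3).2.2.2.self_of_nhds.2 hr2 hr1 this
  rw [this]

lemma local_struct {ZV : Finset ℂ} {τ : ℂ → (Fin n → ℂ) → ℂ} {ZW : Finset ℂ} {μ : ℂ → (Fin n → ℂ) → ℂ}
    {x0 w : Fin n → ℂ} {s1 : ℂ} (h : c.Nice ZV τ ZW μ (x0 + s1 • w)) :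
    ∃ I ⊆ ZV ×ˢ ZW, (∀ p ∈ I, ∀ q ∈ I, p.1 = q.1 → p = q) ∧ ∀ᶠ s in 𝓝 s1,
      c.Nice ZV τ ZW μ (x0 + s • w) ∧
      c.S x0 w s = (fun p : ℂ × ℂ => (τ p.1 (x0 + s • w), μ p.2 (x0 + s • w))) '' I := by
  classical
  obtain ⟨ρ, hρ, hb⟩ := Metric.eventually_nhds_iff_ball.1 (line_eventually h.eventually)
  have hκ : ∀ r ∈ ZV, ∀ s ∈ Metric.ball s1 ρ, AnalyticAt ℂ (c.κ x0 w (τ r)) s := fun r hr s hs =>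
    c.κ_ana (hb s hs).1 ((hb s hs).2.1.1 r hr) (((hb s hs).2.1.2.self_of_nhds.1 _).2 ⟨r, hr, rfl⟩)
  have hK0 : ∀ r, ∃ K : ℂ → Fin n → ℂ, r ∈ ZV → ∀ s ∈ Metric.ball s1 ρ,
      HasDerivAt K (c.κ x0 w (τ r) s) s := by
    intro r
    by_cases hr : r ∈ ZV
    · obtain ⟨K, hK⟩ := DifferentiableOn.isExactOn_ball (f := c.κ x0 w (τ r)) (c := s1) (r := ρ)
        fun s hs => (hκ r hr s hs).differentiableAt.differentiableWithinAt
      exact ⟨K, fun _ => hK⟩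
    · exact ⟨fun _ => 0, fun h => absurd h hr⟩
  choose K hK using hK0
  have hKa : ∀ r ∈ ZV, ∀ s ∈ Metric.ball s1 ρ, AnalyticAt ℂ (K r) s := fun r hr =>
    DifferentiableOn.analyticOnNhd (fun s hs => (hK r hr s hs).differentiableAt.differentiableWithinAt)
      Metric.isOpen_ball
  refine ⟨(ZV ×ˢ ZW).filter (c.Pred ZV τ ZW μ x0 w s1 ρ K), Finset.filter_subset _ _, ?_, ?_⟩
  · intro p hp q hq hpq
    exact Pred.inj hρ hb hKa (Finset.mem_filter.1 hp).2 (Finset.mem_filter.1 hq).2 hpq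
  · filter_upwards [Metric.ball_mem_nhds s1 hρ] with s hs
    refine ⟨hb s hs, ?_⟩
    ext q
    constructor
    · intro hq
      obtain ⟨p, hp, e⟩ := Pred.of_mem hb hK hKa hs hq
      refine ⟨p, ?_, e⟩
      simp only [Finset.coe_filter, Finset.mem_product, Set.mem_ofPred_eq]
      exact ⟨⟨hp.1, hp.2.1⟩, hp⟩
    · rintro ⟨p, hp, rfl⟩
      exact Pred.mem hb hKa (Finset.mem_filter.1 hp).2 hs

end Core

/-- polynomial bound along lines with uniform exponent -/
def PB {n : ℕ} (F : (Fin n → ℂ) → ℝ) : Prop :=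
  ∃ N : ℕ, ∀ x0 w : Fin n → ℂ, ∃ C : ℝ, 0 ≤ C ∧ ∀ s : ℂ, F (x0 + s • w) ≤ C * (1 + ‖s‖) ^ N

lemma PB.add {n : ℕ} {F G : (Fin n → ℂ) → ℝ} (hF : PB F) (hG : PB G) : PB (fun x => F x + G x) := by
  obtain ⟨N, hF⟩ := hF
  obtain ⟨M, hG⟩ := hG
  refine ⟨max N M, fun x0 w => ?_⟩
  obtain ⟨C, hC, h1⟩ := hF x0 w
  obtain ⟨D, hD, h2⟩ := hG x0 w
  refine ⟨C + D, by positivity, fun s => ?_⟩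
  have h0 : 1 ≤ 1 + ‖s‖ := by linarith [norm_nonneg s]
  calc _ ≤ C * (1 + ‖s‖) ^ N + D * (1 + ‖s‖) ^ M := add_le_add (h1 s) (h2 s)
    _ ≤ C * (1 + ‖s‖) ^ (max N M) + D * (1 + ‖s‖) ^ (max N M) := by
      gcongr <;> first | exact h0 | simp
    _ = _ := by ring

lemma PB.mul {n : ℕ} {F G : (Fin n → ℂ) → ℝ} (hF : PB F) (hG : PB G) (hG0 : ∀ x, 0 ≤ G x) :
    PB (fun x => F x * G x) := by
  obtain ⟨N, hF⟩ := hF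
  obtain ⟨M, hG⟩ := hG
  refine ⟨N + M, fun x0 w => ?_⟩
  obtain ⟨C, hC, h1⟩ := hF x0 w
  obtain ⟨D, hD, h2⟩ := hG x0 w
  refine ⟨C * D, by positivity, fun s => ?_⟩
  calc _ ≤ (C * (1 + ‖s‖) ^ N) * (D * (1 + ‖s‖) ^ M) :=
        mul_le_mul (h1 s) (h2 s) (hG0 _) (by positivity)
    _ = _ := by ring

lemma PB.mono {n : ℕ} {F G : (Fin n → ℂ) → ℝ} (hG : PB G) (h : ∀ x, F x ≤ G x) : PB F := by
  obtain ⟨N, hG⟩ := hG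
  refine ⟨N, fun x0 w => ?_⟩
  obtain ⟨C, hC, h1⟩ := hG x0 w
  exact ⟨C, hC, fun s => (h _).trans (h1 s)⟩

lemma PB.const {n : ℕ} (a : ℝ) (ha : 0 ≤ a) : PB (fun _ : Fin n → ℂ => a) :=
  ⟨0, fun _ _ => ⟨a, ha, fun s => by simp⟩⟩

lemma PB.sum {n : ℕ} {ι : Type*} (T : Finset ι) {F : ι → (Fin n → ℂ) → ℝ} (h : ∀ i ∈ T, PB (F i)) :
    PB (fun x => ∑ i ∈ T, F i x) := by
  classical
  induction T using Finset.induction_on with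
  | empty => simpa using PB.const 0 le_rfl
  | insert a T ha ih =>
    have := (h a (by simp)).add (ih fun i hi => h i (by simp [hi]))
    refine this.mono fun x => ?_
    rw [Finset.sum_insert ha]

lemma PB.pow {n : ℕ} {F : (Fin n → ℂ) → ℝ} (h : PB F) (h0 : ∀ x, 0 ≤ F x) (m : ℕ) :
    PB (fun x => F x ^ m) := by
  induction m with
  | zero => simpa using PB.const 1 zero_le_one
  | succ m ih => simpa [pow_succ] using ih.mul h h0

lemma PB.poly {n : ℕ} (P : MvPolynomial (Fin n) ℂ) : PB (fun x => ‖eval x P‖) := by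
  induction P using MvPolynomial.induction_on with
  | C a => simpa using PB.const ‖a‖ (norm_nonneg a)
  | add p q hp hq =>
    refine (hp.add hq).mono fun x => ?_
    rw [map_add]; exact norm_add_le _ _
  | mul_X p i hp =>
    have hx : PB (fun x : Fin n → ℂ => ‖x i‖) := by
      refine ⟨1, fun x0 w => ⟨‖x0 i‖ + ‖w i‖, by positivity, fun s => ?_⟩⟩
      simp only [Pi.add_apply, Pi.smul_apply, smul_eq_mul, pow_one]
      refine (norm_add_le _ _).trans ?_
      rw [norm_mul]
      nlinarith [norm_nonneg (x0 i), norm_nonneg (w i), norm_nonneg s,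
        mul_nonneg (norm_nonneg (x0 i)) (norm_nonneg s)]
    refine (hp.mul hx fun x => norm_nonneg _).mono fun x => ?_
    simp

/-- bound function for roots -/
noncomputable def rb {n : ℕ} (V : Polynomial (MvPolynomial (Fin n) ℂ)) (x : Fin n → ℂ) : ℝ :=
  ∑ i ∈ Finset.range (V.natDegree + 1), ‖eval x (V.coeff i)‖

lemma rb_nonneg {n : ℕ} (V : Polynomial (MvPolynomial (Fin n) ℂ)) (x : Fin n → ℂ) : 0 ≤ rb V x :=
  Finset.sum_nonneg fun _ _ => norm_nonneg _

lemma rb_PB {n : ℕ} (V : Polynomial (MvPolynomial (Fin n) ℂ)) : PB (rb V) :=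
  PB.sum _ fun _ _ => PB.poly _

lemma root_bound {n : ℕ} (V : Polynomial (MvPolynomial (Fin n) ℂ)) (x : Fin n → ℂ) (t : ℂ)
    (h : ev V x t = 0) : ‖eval x V.leadingCoeff * t‖ ≤ rb V x := by
  by_cases ha : eval x V.leadingCoeff = 0
  · rw [ha]; simpa using rb_nonneg V x
  have hd : (V.map (eval x)).natDegree = V.natDegree :=
    Polynomial.natDegree_map_of_leadingCoeff_ne_zero _ ha
  have hl : (V.map (eval x)).leadingCoeff = eval x V.leadingCoeff := by
    rw [Polynomial.leadingCoeff, hd, Polynomial.coeff_map]; rfl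
  have h0 : V.map (eval x) ≠ 0 := fun h0 => ha (by rw [← hl, h0]; simp)
  have h1 := Polynomial.IsRoot.norm_lt_cauchyBound h0 (show (V.map (eval x)).IsRoot t from h)
  rw [Polynomial.cauchyBound, hd, hl] at h1
  have h1' : ‖t‖ ≤ (Finset.sup (Finset.range V.natDegree) (fun i => ‖(V.map (eval x)).coeff i‖₊) : NNReal) /
      ‖eval x V.leadingCoeff‖ + 1 := by
    have := h1.le
    rw [← NNReal.coe_le_coe] at this
    simpa using this
  have hsup : ((Finset.sup (Finset.range V.natDegree) (fun i => ‖(V.map (eval x)).coeff i‖₊) : NNReal) : ℝ)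
      ≤ ∑ i ∈ Finset.range V.natDegree, ‖eval x (V.coeff i)‖ := by
    have : Finset.sup (Finset.range V.natDegree) (fun i => ‖(V.map (eval x)).coeff i‖₊) ≤
        ∑ i ∈ Finset.range V.natDegree, ‖eval x (V.coeff i)‖₊ := by
      refine Finset.sup_le fun i hi => ?_
      rw [Polynomial.coeff_map]
      exact Finset.single_le_sum (f := fun i => ‖eval x (V.coeff i)‖₊) (fun _ _ => zero_le) hi
    rw [← NNReal.coe_le_coe] at this
    simpa using this
  have hpos : 0 < ‖eval x V.leadingCoeff‖ := norm_pos_iff.2 ha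
  rw [norm_mul, rb, Finset.sum_range_succ]
  refine (mul_le_mul_of_nonneg_left h1' hpos.le).trans ?_
  rw [mul_add, mul_one, mul_div_cancel₀ _ hpos.ne', Polynomial.leadingCoeff]
  gcongr

lemma roots_card {n : ℕ} (V : Polynomial (MvPolynomial (Fin n) ℂ)) (x : Fin n → ℂ)
    (ha : eval x V.leadingCoeff ≠ 0) : ∃ T : Finset ℂ, T.card ≤ V.natDegree ∧ ∀ t, ev V x t = 0 → t ∈ T := by
  classical
  have hd : (V.map (eval x)).natDegree = V.natDegree :=
    Polynomial.natDegree_map_of_leadingCoeff_ne_zero _ ha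
  have h0 : V.map (eval x) ≠ 0 := fun h0 => ha (by
    have := congrArg (fun p => Polynomial.coeff p V.natDegree) h0
    simpa [Polynomial.coeff_map] using this)
  refine ⟨(V.map (eval x)).roots.toFinset, ?_, fun t ht => ?_⟩
  · exact (Multiset.toFinset_card_le _).trans ((Polynomial.card_roots' _).trans hd.le)
  · rw [Multiset.mem_toFinset, Polynomial.mem_roots h0]; exact ht

lemma line_zeros {n : ℕ} (N : MvPolynomial (Fin n) ℂ) (x0 w : Fin n → ℂ) (h : eval x0 N ≠ 0) :
    ∃ E : Finset ℂ, ∀ s, s ∉ E → eval (x0 + s • w) N ≠ 0 := by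
  classical
  set P : Polynomial ℂ := aeval (fun j => Polynomial.C (x0 j) + Polynomial.X * Polynomial.C (w j)) N with hP
  have he : ∀ s, P.eval s = eval (x0 + s • w) N := by
    intro s
    have : ((Polynomial.aeval s : Polynomial ℂ →ₐ[ℂ] ℂ).comp
      (aeval (fun j => Polynomial.C (x0 j) + Polynomial.X * Polynomial.C (w j)) :
        MvPolynomial (Fin n) ℂ →ₐ[ℂ] Polynomial ℂ)) = aeval (x0 + s • w) := by
      ext j
      simp; ring
    have h2 := DFunLike.congr_fun this N
    simpa [hP, Polynomial.coe_aeval_eq_eval] using h2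
  have hP0 : P ≠ 0 := by
    intro h0
    apply h
    have := he 0
    rw [h0] at this
    simpa using this.symm
  refine ⟨P.roots.toFinset, fun s hs h0 => hs ?_⟩
  rw [Multiset.mem_toFinset, Polynomial.mem_roots hP0]
  exact (he s).trans h0

namespace Core
variable {n : ℕ} (c : Core n)

/-- power sums over the solution set -/
noncomputable def q (m e : ℕ) (x0 w : Fin n → ℂ) (s : ℂ) : ℂ :=
  ∑ᶠ p ∈ c.S x0 w s, (eval (x0 + s • w) c.V.leadingCoeff * p.1) ^ m *
    (eval (x0 + s • w) c.W.leadingCoeff * p.2) ^ e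

/-- power sums over branches -/
noncomputable def Q (τ μ : ℂ → (Fin n → ℂ) → ℂ) (I : Finset (ℂ × ℂ)) (m e : ℕ) (x : Fin n → ℂ) : ℂ :=
  ∑ p ∈ I, (eval x c.V.leadingCoeff * τ p.1 x) ^ m * (eval x c.W.leadingCoeff * μ p.2 x) ^ e

variable {c} in
lemma Nice.injOn {ZV : Finset ℂ} {τ : ℂ → (Fin n → ℂ) → ℂ} {ZW : Finset ℂ} {μ : ℂ → (Fin n → ℂ) → ℂ}
    {x : Fin n → ℂ} (h : c.Nice ZV τ ZW μ x) {I : Finset (ℂ × ℂ)} (hI : I ⊆ ZV ×ˢ ZW) :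
    Set.InjOn (fun p : ℂ × ℂ => (τ p.1 x, μ p.2 x)) I := by
  intro p hp r hr hpr
  have h1 := Finset.mem_product.1 (hI hp)
  have h2 := Finset.mem_product.1 (hI hr)
  simp only [Prod.mk.injEq] at hpr
  exact Prod.ext (h.2.1.2.self_of_nhds.2 h1.1 h2.1 hpr.1) (h.2.2.2.self_of_nhds.2 h1.2 h2.2 hpr.2)

variable {c} in
lemma Nice.q_eq {ZV : Finset ℂ} {τ : ℂ → (Fin n → ℂ) → ℂ} {ZW : Finset ℂ} {μ : ℂ → (Fin n → ℂ) → ℂ}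
    {x0 w : Fin n → ℂ} {s : ℂ} (h : c.Nice ZV τ ZW μ (x0 + s • w)) {I : Finset (ℂ × ℂ)}
    (hI : I ⊆ ZV ×ˢ ZW)
    (hS : c.S x0 w s = (fun p : ℂ × ℂ => (τ p.1 (x0 + s • w), μ p.2 (x0 + s • w))) '' I) (m e : ℕ) :
    c.q m e x0 w s = c.Q τ μ I m e (x0 + s • w) := by
  rw [q, hS, finsum_mem_image (h.injOn hI), finsum_mem_coe_finset, Q]

variable {c} in
lemma Nice.Q_ana {ZV : Finset ℂ} {τ : ℂ → (Fin n → ℂ) → ℂ} {ZW : Finset ℂ} {μ : ℂ → (Fin n → ℂ) → ℂ}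
    {x : Fin n → ℂ} (h : c.Nice ZV τ ZW μ x) {I : Finset (ℂ × ℂ)} (hI : I ⊆ ZV ×ˢ ZW) (m e : ℕ) :
    AnalyticAt ℂ (c.Q τ μ I m e) x := by
  refine Finset.analyticAt_fun_sum _ fun p hp => ?_
  have h1 := Finset.mem_product.1 (hI hp)
  exact (((mvpoly_ent _ _).fun_mul (h.2.1.1 _ h1.1)).fun_pow m).fun_mul
    (((mvpoly_ent _ _).fun_mul (h.2.2.1 _ h1.2)).fun_pow e)

lemma q_diff {x0 w : Fin n → ℂ} {s : ℂ} (h : eval (x0 + s • w) c.N ≠ 0) (m e : ℕ) :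
    DifferentiableAt ℂ (c.q m e x0 w) s := by
  obtain ⟨ZV, τ, ZW, μ, hn⟩ := c.exists_nice h
  obtain ⟨I, hI, _, hev⟩ := c.local_struct hn
  have h1 : AnalyticAt ℂ (fun s : ℂ => c.Q τ μ I m e (x0 + s • w)) s :=
    AnalyticAt.fun_comp (g := c.Q τ μ I m e) (f := fun s : ℂ => x0 + s • w) (hn.Q_ana hI m e) (line_ana x0 w s)
  refine h1.differentiableAt.congr_of_eventuallyEq ?_
  filter_upwards [hev] with z hz using hz.1.q_eq hI hz.2 m e

lemma q_bound {x0 w : Fin n → ℂ} {s : ℂ} (h : eval (x0 + s • w) c.N ≠ 0) (m e : ℕ) :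
    ‖c.q m e x0 w s‖ ≤ (c.V.natDegree * c.W.natDegree : ℕ) * (rb c.V (x0 + s • w) ^ m * rb c.W (x0 + s • w) ^ e) := by
  classical
  obtain ⟨ZV, τ, ZW, μ, hn⟩ := c.exists_nice h
  obtain ⟨I, hI, _, hev⟩ := c.local_struct hn
  have hS := hev.self_of_nhds.2
  obtain ⟨T1, c1, m1⟩ := roots_card c.V _ (c.Vlc _ h)
  obtain ⟨T2, c2, m2⟩ := roots_card c.W _ (c.Wlc _ h)
  have hmem : ∀ p ∈ I, ev c.V (x0 + s • w) (τ p.1 (x0 + s • w)) = 0 ∧ ev c.W (x0 + s • w) (μ p.2 (x0 + s • w)) = 0 := by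
    intro p hp
    have h1 := Finset.mem_product.1 (hI hp)
    exact ⟨(hn.2.1.2.self_of_nhds.1 _).2 ⟨_, h1.1, rfl⟩, (hn.2.2.2.self_of_nhds.1 _).2 ⟨_, h1.2, rfl⟩⟩
  have hcard : I.card ≤ c.V.natDegree * c.W.natDegree := by
    calc I.card ≤ (T1 ×ˢ T2).card := Finset.card_le_card_of_injOn _ (fun p hp => by
            simp only [Finset.coe_product, Set.mem_prod, Finset.mem_coe]
            exact ⟨m1 _ (hmem p hp).1, m2 _ (hmem p hp).2⟩) (hn.injOn hI)
      _ = T1.card * T2.card := Finset.card_product _ _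
      _ ≤ _ := Nat.mul_le_mul c1 c2
  have hr1 := rb_nonneg c.V (x0 + s • w)
  have hr2 := rb_nonneg c.W (x0 + s • w)
  rw [hn.q_eq hI hS m e, Q]
  calc _ ≤ ∑ p ∈ I, (rb c.V (x0 + s • w) ^ m * rb c.W (x0 + s • w) ^ e) := by
        refine norm_sum_le_of_le _ fun p hp => ?_
        rw [norm_mul, norm_pow, norm_pow]
        have := root_bound _ _ _ (hmem p hp).1
        have := root_bound _ _ _ (hmem p hp).2
        gcongr
    _ = I.card * (rb c.V (x0 + s • w) ^ m * rb c.W (x0 + s • w) ^ e) := by simp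
    _ ≤ _ := by gcongr

lemma line_poly (m e : ℕ) : ∃ L : ℕ, ∀ x0 w, eval x0 c.N ≠ 0 → ∃ q' : ℂ → ℂ, q' =ᶠ[𝓝 0] c.q m e x0 w ∧
    ∀ j, L < j → iteratedDeriv j q' 0 = 0 := by
  classical
  have hPB : PB (fun x => ((c.V.natDegree * c.W.natDegree : ℕ) : ℝ) * (rb c.V x ^ m * rb c.W x ^ e)) := by
    refine (PB.const _ (by positivity)).mul ?_ ?_
    · exact ((rb_PB _).pow (rb_nonneg _) m).mul ((rb_PB _).pow (rb_nonneg _) e)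
        fun x => pow_nonneg (rb_nonneg _ x) _
    · exact fun x => mul_nonneg (pow_nonneg (rb_nonneg _ x) _) (pow_nonneg (rb_nonneg _ x) _)
  obtain ⟨L, hL⟩ := hPB
  refine ⟨L, fun x0 w hx0 => ?_⟩
  obtain ⟨C, _, hC⟩ := hL x0 w
  obtain ⟨E0, hE0⟩ := line_zeros c.N x0 w hx0
  set E := E0.filter (fun s => eval (x0 + s • w) c.N = 0) with hE
  have hEs : ∀ s, s ∉ E → eval (x0 + s • w) c.N ≠ 0 := by
    intro s hs h0
    exact hE0 s (fun hmem => hs (by rw [hE, Finset.mem_filter]; exact ⟨hmem, h0⟩)) h0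
  have h0E : (0:ℂ) ∉ E := by
    rw [hE, Finset.mem_filter]
    rintro ⟨_, h⟩
    exact hx0 (by simpa using h)
  obtain ⟨q', _, h2, h3⟩ := liouville_finset E (c.q m e x0 w) (fun s hs => c.q_diff (hEs s hs) m e) C L
    (fun s hs => (c.q_bound (hEs s hs) m e).trans (hC s))
  refine ⟨q', ?_, h3⟩
  have : ∀ᶠ s in 𝓝 (0:ℂ), s ∉ E := E.finite_toSet.isClosed.isOpen_compl.mem_nhds h0E
  filter_upwards [this] with s hs using h2 s hs

end Core

lemma diag_poly {n j : ℕ} (f : ContinuousMultilinearMap ℂ (fun _ : Fin j => Fin n → ℂ) ℂ) :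
    ∃ P : MvPolynomial (Fin n) ℂ, ∀ y, f (fun _ => y) = eval y P := by
  classical
  refine ⟨∑ r : Fin j → Fin n, C (f (fun l => Pi.single (r l) 1)) * ∏ l, X (r l), fun y => ?_⟩
  have hy : y = ∑ i, y i • (Pi.single i (1:ℂ) : Fin n → ℂ) := pi_eq_sum_univ' y
  conv_lhs => rw [hy]
  rw [f.map_sum (g := fun _ i => y i • (Pi.single i (1:ℂ) : Fin n → ℂ)), map_sum]
  refine Finset.sum_congr rfl fun r _ => ?_
  rw [f.map_smul_univ, map_mul, eval_C, map_prod]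
  simp [mul_comm]

lemma line_series {n : ℕ} {F : (Fin n → ℂ) → ℂ} {p : FormalMultilinearSeries ℂ (Fin n → ℂ) ℂ} {x0 : Fin n → ℂ}
    (h : HasFPowerSeriesAt F p x0) (w : Fin n → ℂ) (j : ℕ) :
    iteratedDeriv j (fun s : ℂ => F (x0 + s • w)) 0 = (j.factorial : ℂ) * p j (fun _ => w) := by
  obtain ⟨r, hr⟩ := h
  have h1 : HasFPowerSeriesOnBall (fun y => F (x0 + y)) p 0 r := by
    have := hr.comp_sub (-x0)
    simpa [sub_neg_eq_add, add_comm] using this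
  have h2 : HasFPowerSeriesAt (fun y => F (x0 + y)) p ((ContinuousLinearMap.toSpanSingleton ℂ w) 0) := by
    simpa using h1.hasFPowerSeriesAt
  obtain ⟨r', hr'⟩ := h2.compContinuousLinearMap
  have h3 := hr'.factorial_smul 1 j
  rw [FormalMultilinearSeries.compContinuousLinearMap_apply] at h3
  rw [iteratedDeriv_eq_iteratedFDeriv]
  simpa [Function.comp_def] using h3.symm

lemma poly_of_series {n : ℕ} {F : (Fin n → ℂ) → ℂ} {p : FormalMultilinearSeries ℂ (Fin n → ℂ) ℂ} {x0 : Fin n → ℂ}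
    (h : HasFPowerSeriesAt F p x0) (L : ℕ) (hp : ∀ j, L < j → ∀ w, p j (fun _ => w) = 0) :
    ∃ P : MvPolynomial (Fin n) ℂ, ∀ᶠ x in 𝓝 x0, F x = eval x P := by
  choose P hP using fun j => diag_poly (p j)
  set sh : MvPolynomial (Fin n) ℂ →ₐ[ℂ] MvPolynomial (Fin n) ℂ := aeval (fun j => X j - C (x0 j))
  have hsh : ∀ (R : MvPolynomial (Fin n) ℂ) (x : Fin n → ℂ), eval x (sh R) = eval (x - x0) R := by
    intro R x
    have : (aeval x : MvPolynomial (Fin n) ℂ →ₐ[ℂ] ℂ).comp sh = aeval (x - x0) := by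
      ext j; simp [sh]
    have h2 := DFunLike.congr_fun this R
    simpa [MvPolynomial.coe_aeval_eq_eval] using h2
  refine ⟨∑ j ∈ Finset.range (L + 1), sh (P j), ?_⟩
  filter_upwards [h.eventually_hasSum_sub] with x hx
  have h1 : HasSum (fun j => p j fun _ => x - x0) (∑ j ∈ Finset.range (L + 1), p j fun _ => x - x0) :=
    hasSum_sum_of_ne_finset_zero fun j hj => hp j (by simpa using hj) _
  rw [hx.unique h1, map_sum]
  exact Finset.sum_congr rfl fun j _ => by rw [hsh, hP]

namespace Core
variable {n : ℕ} (c : Core n)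

lemma mem_S {u0 : Fin n → ℂ} (hu : c.H u0 ≠ 0) (w : Fin n → ℂ) :
    (c.θ u0, c.f u0) ∈ c.S (fun j => c.φ j u0) w 0 := by
  obtain ⟨ι, a1, a2, a3, a4⟩ := c.inverse_near hu
  set x0 := (fun j => c.φ j u0) with hx0
  have h0 : x0 + (0:ℂ) • w = x0 := by simp
  have hline : Tendsto (fun s : ℂ => x0 + s • w) (𝓝 0) (𝓝 x0) := by
    have := (line_ana x0 w 0).continuousAt.tendsto
    simpa using this
  have hana : AnalyticAt ℂ (fun s : ℂ => ι (x0 + s • w)) 0 :=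
    AnalyticAt.fun_comp (g := ι) (f := fun s : ℂ => x0 + s • w) (by rw [h0]; exact a1) (line_ana x0 w 0)
  have hval : ι (x0 + (0:ℂ) • w) = u0 := by rw [h0, a2]
  have hT : Tendsto (fun s : ℂ => ι (x0 + s • w)) (𝓝 0) (𝓝 u0) := by
    have := hana.continuousAt.tendsto
    rwa [hval] at this
  refine ⟨fun s => ι (x0 + s • w), hana, ?_, ?_, ?_⟩
  · apply nhdsWithin_le_nhds
    filter_upwards [hT.eventually ((c.H_an u0).continuousAt.eventually_ne hu), hline.eventually a3] with s k1 k2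
    exact ⟨k1, k2⟩
  · exact ((c.gθ.analyticAt c.H_an hu).continuousAt.tendsto.comp hT).mono_left nhdsWithin_le_nhds
  · exact ((c.gf.analyticAt c.H_an hu).continuousAt.tendsto.comp hT).mono_left nhdsWithin_le_nhds

lemma single_I {u0 : Fin n → ℂ} (hu : c.H u0 ≠ 0) {ZV : Finset ℂ} {τ : ℂ → (Fin n → ℂ) → ℂ} {ZW : Finset ℂ}
    {μ : ℂ → (Fin n → ℂ) → ℂ} (hn : c.Nice ZV τ ZW μ (fun j => c.φ j u0)) :
    ∃ I ⊆ ZV ×ˢ ZW, (∀ p ∈ I, ∀ q ∈ I, p.1 = q.1 → p = q) ∧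
      (∃ p ∈ I, τ p.1 (fun j => c.φ j u0) = c.θ u0 ∧ μ p.2 (fun j => c.φ j u0) = c.f u0) ∧
      ∀ m e, ∃ P : MvPolynomial (Fin n) ℂ, ∀ᶠ x in 𝓝 (fun j => c.φ j u0), c.Q τ μ I m e x = eval x P := by
  classical
  set x0 := (fun j => c.φ j u0) with hx0
  choose L hL using c.line_poly
  have hser : ∀ I m e, ∃ p : FormalMultilinearSeries ℂ (Fin n → ℂ) ℂ, I ⊆ ZV ×ˢ ZW →
      HasFPowerSeriesAt (c.Q τ μ I m e) p x0 := by
    intro I m e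
    by_cases hI : I ⊆ ZV ×ˢ ZW
    · obtain ⟨p, hp⟩ := hn.Q_ana hI m e
      exact ⟨p, fun _ => hp⟩
    · exact ⟨0, fun h => absurd h hI⟩
  choose p hp using hser
  set adm : Finset (ℂ × ℂ) → Prop := fun I => I ⊆ ZV ×ˢ ZW ∧ (∀ p ∈ I, ∀ q ∈ I, p.1 = q.1 → p = q) ∧
      (∃ p ∈ I, τ p.1 x0 = c.θ u0 ∧ μ p.2 x0 = c.f u0) with hadm
  have hw : ∀ w, ∃ I, adm I ∧ ∀ m e j, L m e < j → p I m e j (fun _ => w) = 0 := by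
    intro w
    have h0 : x0 + (0:ℂ) • w = x0 := by simp
    obtain ⟨I, hI, hinj, hev⟩ := c.local_struct (x0 := x0) (w := w) (s1 := 0) (by rw [h0]; exact hn)
    refine ⟨I, ⟨hI, hinj, ?_⟩, ?_⟩
    · have hm := c.mem_S hu w
      rw [← hx0, hev.self_of_nhds.2] at hm
      obtain ⟨r, hr, he⟩ := hm
      simp only [h0, Prod.mk.injEq] at he
      exact ⟨r, hr, he⟩
    · intro m e j hj
      obtain ⟨q', h1, h2⟩ := hL m e x0 w hn.1
      have h3 : q' =ᶠ[𝓝 0] fun s : ℂ => c.Q τ μ I m e (x0 + s • w) := by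
        filter_upwards [h1, hev] with s k1 k2
        rw [k1, k2.1.q_eq hI k2.2]
      have h4 := line_series (hp I m e hI) w j
      rw [← h3.iteratedDeriv_eq j, h2 j hj] at h4
      have := mul_eq_zero.1 h4.symm
      exact this.resolve_left (by exact_mod_cast j.factorial_ne_zero)
  have hone : ∃ I, adm I ∧ ∀ m e j, L m e < j → ∀ w, p I m e j (fun _ => w) = 0 := by
    by_contra hcon
    push Not at hcon
    have hcon' : ∀ I, ∃ (m e j : ℕ), adm I → L m e < j ∧ ∃ w, p I m e j (fun _ => w) ≠ 0 := by
      intro I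
      by_cases h : adm I
      · obtain ⟨m, e, j, a, b⟩ := hcon I h
        exact ⟨m, e, j, fun _ => ⟨a, b⟩⟩
      · exact ⟨0, 0, 0, fun h' => absurd h' h⟩
    choose m e j hmej using hcon'
    obtain ⟨w, hw'⟩ := ent_prod ((ZV ×ˢ ZW).powerset.filter adm)
      (fun I w => p I (m I) (e I) (j I) (fun _ => w)) (by
        intro I _ u
        obtain ⟨P, hP⟩ := diag_poly (p I (m I) (e I) (j I))
        simp only [hP]
        exact mvpoly_ent P u) (fun I hI => (hmej I (Finset.mem_filter.1 hI).2).2)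
    obtain ⟨I, h1, h2⟩ := hw w
    refine (Finset.prod_ne_zero_iff.1 hw' I ?_) (h2 _ _ _ (hmej I h1).1)
    exact Finset.mem_filter.2 ⟨Finset.mem_powerset.2 h1.1, h1⟩
  obtain ⟨I, ⟨h1, h2, h3⟩, h4⟩ := hone
  exact ⟨I, h1, h2, h3, fun m e => poly_of_series (hp I m e h1) (L m e) (h4 m e)⟩

end Core

lemma vand_solve {d : ℕ} (y z : Fin d → ℂ) (hy : Function.Injective y) (G : Matrix (Fin d) (Fin d) ℂ)
    (q : Fin d → ℂ) (hG : ∀ l m, G l m = ∑ i, y i ^ ((l : ℕ) + m)) (hq : ∀ l, q l = ∑ i, y i ^ (l : ℕ) * z i) :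
    G.det ≠ 0 ∧ ∀ i, ∑ l, (G.adjugate.mulVec q) l * y i ^ (l : ℕ) = G.det * z i := by
  set v := Matrix.vandermonde y with hv
  have hvdet : v.det ≠ 0 := Matrix.det_vandermonde_ne_zero_iff.2 hy
  have hG' : G = v.transpose * v := by
    ext l m
    rw [hG, Matrix.mul_apply]
    exact Finset.sum_congr rfl fun i _ => by simp [hv, Matrix.vandermonde_apply, pow_add]
  have hq' : q = v.transpose.mulVec z := by
    ext l
    rw [hq, Matrix.mulVec]
    exact Finset.sum_congr rfl fun i _ => by simp [hv, Matrix.vandermonde_apply]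
  have hGdet : G.det ≠ 0 := by
    rw [hG', Matrix.det_mul, Matrix.det_transpose]
    exact mul_ne_zero hvdet hvdet
  refine ⟨hGdet, ?_⟩
  set a := G.adjugate.mulVec q with ha
  have h1 : G.mulVec a = G.det • q := by
    rw [ha, Matrix.mulVec_mulVec, Matrix.mul_adjugate, Matrix.smul_mulVec, Matrix.one_mulVec]
  have h2 : v.transpose.mulVec (v.mulVec a) = v.transpose.mulVec (G.det • z) := by
    rw [Matrix.mulVec_mulVec, ← hG', h1, hq', Matrix.mulVec_smul]
  have h3 : v.mulVec a = G.det • z := by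
    have hu : IsUnit v.transpose := by
      rw [Matrix.isUnit_iff_isUnit_det, Matrix.det_transpose]; exact isUnit_iff_ne_zero.2 hvdet
    exact Matrix.mulVec_injective_of_isUnit hu h2
  intro i
  have := congrFun h3 i
  rw [Matrix.mulVec] at this
  simp only [Pi.smul_apply, smul_eq_mul] at this
  rw [← this]
  exact Finset.sum_congr rfl fun l _ => by simp [hv, Matrix.vandermonde_apply, mul_comm]

namespace Core
variable {n : ℕ} (c : Core n)

theorem main {u0 : Fin n → ℂ} (hu : c.H u0 ≠ 0) : ∃ C D : Polynomial (MvPolynomial (Fin n) ℂ),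
    ev D (fun j => c.φ j u0) (c.θ u0) ≠ 0 ∧
    ∀ᶠ u in 𝓝 u0, c.f u * ev D (fun j => c.φ j u) (c.θ u) = ev C (fun j => c.φ j u) (c.θ u) := by
  classical
  obtain ⟨ZV, τ, ZW, μ, hn⟩ := c.exists_nice (c.hN u0 hu)
  obtain ⟨I, hI, hinj, ⟨p0, hp0, hp1, hp2⟩, hP⟩ := c.single_I hu hn
  choose P hP using hP
  set x0 := (fun j => c.φ j u0) with hx0
  set d := I.card
  let σ : Fin d ≃ I := I.equivFin.symm
  set a := c.V.leadingCoeff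
  set b := c.W.leadingCoeff
  let G : Matrix (Fin d) (Fin d) (MvPolynomial (Fin n) ℂ) := Matrix.of fun l m => P ((l : ℕ) + m) 0
  let q : Fin d → MvPolynomial (Fin n) ℂ := fun l => P l 1
  let A : Fin d → MvPolynomial (Fin n) ℂ := G.adjugate.mulVec q
  -- pointwise statement
  have hpt : ∀ᶠ x in 𝓝 x0, eval x G.det ≠ 0 ∧ ∀ p ∈ I, ∑ l, eval x (A l) * (eval x a * τ p.1 x) ^ (l : ℕ) =
      eval x G.det * (eval x b * μ p.2 x) := by
    have hfin : ∀ᶠ x in 𝓝 x0, (∀ l m : Fin d, c.Q τ μ I ((l : ℕ) + m) 0 x = eval x (P ((l : ℕ) + m) 0)) ∧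
        ∀ l : Fin d, c.Q τ μ I l 1 x = eval x (P l 1) := by
      refine Filter.Eventually.and ?_ ?_
      · exact eventually_all.2 fun l => eventually_all.2 fun m => hP _ _
      · exact eventually_all.2 fun l => hP _ _
    filter_upwards [hfin, hn.eventually] with x hx hnx
    let y : Fin d → ℂ := fun i => eval x a * τ (σ i).1.1 x
    let z : Fin d → ℂ := fun i => eval x b * μ (σ i).1.2 x
    have hy : Function.Injective y := by
      intro i j hij
      have h1 := mul_left_cancel₀ (c.Vlc x hnx.1) hij
      have h2 := hnx.2.1.2.self_of_nhds.2 (Finset.mem_product.1 (hI (σ i).2)).1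
        (Finset.mem_product.1 (hI (σ j).2)).1 h1
      exact σ.injective (Subtype.ext (hinj _ (σ i).2 _ (σ j).2 h2))
    have hsum : ∀ g : ℂ × ℂ → ℂ, ∑ i : Fin d, g (σ i).1 = ∑ p ∈ I, g p := by
      intro g
      rw [Equiv.sum_comp σ (fun p : I => g p.1)]
      exact Finset.sum_coe_sort I g
    obtain ⟨h1, h2⟩ := vand_solve y z hy ((eval x).mapMatrix G) (fun l => eval x (q l)) (by
        intro l m
        have := hx.1 l m
        simp only [RingHom.mapMatrix_apply, Matrix.map_apply, G, Matrix.of_apply]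
        rw [← this, Q, ← hsum]
        simp [y, a]) (by
        intro l
        simp only [q]
        rw [← hx.2 l, Q, ← hsum]
        simp [y, z, a, b])
    rw [← RingHom.map_det] at h1 h2
    refine ⟨h1, fun p hp => ?_⟩
    have h3 := h2 (σ.symm ⟨p, hp⟩)
    simp only [y, z, Equiv.apply_symm_apply] at h3
    rw [← h3]
    refine Finset.sum_congr rfl fun l _ => ?_
    congr 1
    simp only [A, Matrix.mulVec, dotProduct, map_sum, map_mul]
    rw [← RingHom.map_adjugate]
    rfl
  refine ⟨∑ l, Polynomial.C (A l * a ^ (l : ℕ)) * Polynomial.X ^ (l : ℕ), Polynomial.C (G.det * b), ?_, ?_⟩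
  · rw [ev_C, map_mul]
    exact mul_ne_zero hpt.self_of_nhds.1 (c.Wlc _ hn.1)
  · have hφc : Tendsto (fun z => fun j => c.φ j z) (𝓝 u0) (𝓝 x0) :=
      tendsto_pi_nhds.2 fun j => ((c.gφ j).analyticAt c.H_an hu).continuousAt.tendsto
    have hHe := (c.H_an u0).continuousAt.eventually_ne hu
    have hp0' := Finset.mem_product.1 (hI hp0)
    obtain ⟨r, hr, hr1, hr2⟩ := branch_unique hn.2.1.1 hn.2.1.2 hφc
      (c.gθ.analyticAt c.H_an hu).continuousAt.tendsto (hHe.mono fun u hu => c.hV u hu)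
    obtain ⟨r', hr', hr1', hr2'⟩ := branch_unique hn.2.2.1 hn.2.2.2 hφc
      (c.gf.analyticAt c.H_an hu).continuousAt.tendsto (hHe.mono fun u hu => c.hW u hu)
    have e1 : r = p0.1 := hn.2.1.2.self_of_nhds.2 hr hp0'.1 (hr1.trans hp1.symm)
    have e2 : r' = p0.2 := hn.2.2.2.self_of_nhds.2 hr' hp0'.2 (hr1'.trans hp2.symm)
    subst e1 e2
    filter_upwards [hr2, hr2', hφc.eventually hpt] with u k1 k2 k3
    have := k3.2 p0 hp0
    rw [← k1, ← k2] at this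
    rw [ev_C, map_mul]
    have hC : ev (∑ l, Polynomial.C (A l * a ^ (l : ℕ)) * Polynomial.X ^ (l : ℕ)) (fun j => c.φ j u) (c.θ u) =
      ∑ l, eval (fun j => c.φ j u) (A l) * (eval (fun j => c.φ j u) a * c.θ u) ^ (l : ℕ) := by
      rw [ev, Polynomial.map_sum, Polynomial.eval_finsetSum]
      refine Finset.sum_congr rfl fun l _ => ?_
      simp [mul_pow]
      ring
    rw [hC, this]
    ring

end Core

/-- evaluation as a ring hom -/
noncomputable def evHom {n : ℕ} (x : Fin n → ℂ) (t : ℂ) : Polynomial (MvPolynomial (Fin n) ℂ) →+* ℂ :=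
  (Polynomial.evalRingHom t).comp (Polynomial.mapRingHom (eval x))

lemma evHom_apply {n : ℕ} (x : Fin n → ℂ) (t : ℂ) (P : Polynomial (MvPolynomial (Fin n) ℂ)) :
    evHom x t P = ev P x t := rfl

lemma build_M {n : ℕ} (A B : Fin n → Fin n → Polynomial (MvPolynomial (Fin n) ℂ)) :
    ∃ (M : Fin n → Fin n → Polynomial (MvPolynomial (Fin n) ℂ)) (β : Polynomial (MvPolynomial (Fin n) ℂ)),
      ∀ (x : Fin n → ℂ) (t : ℂ) (J : Fin n → Fin n → ℂ), (∀ k p, ev (B k p) x t ≠ 0) →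
        (∀ k p, J k p = ev (A k p) x t / ev (B k p) x t) → Matrix.det (Matrix.of J) ≠ 0 →
        (∀ i p, ∑ k, ev (M i k) x t * J k p = if i = p then ev β x t else 0) ∧ ev β x t ≠ 0 := by
  classical
  let Bt := ∏ kp : Fin n × Fin n, B kp.1 kp.2
  let A' : Matrix (Fin n) (Fin n) (Polynomial (MvPolynomial (Fin n) ℂ)) := Matrix.of fun k p =>
    A k p * ∏ kp ∈ Finset.univ.erase (k, p), B kp.1 kp.2
  refine ⟨fun i k => Bt * A'.adjugate i k, A'.det, fun x t J hB hJ hdet => ?_⟩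
  have hBt : evHom x t Bt ≠ 0 := by
    simp only [Bt, map_prod, Finset.prod_ne_zero_iff]
    intro kp _
    exact hB _ _
  have hA : (evHom x t).mapMatrix A' = (evHom x t Bt) • Matrix.of J := by
    ext k p
    simp only [RingHom.mapMatrix_apply, Matrix.map_apply, Matrix.smul_apply, Matrix.of_apply, A', Bt,
      smul_eq_mul, hJ]
    rw [← Finset.mul_prod_erase Finset.univ (fun kp : Fin n × Fin n => B kp.1 kp.2) (Finset.mem_univ (k, p)),
      map_mul, map_mul, evHom_apply, evHom_apply]
    have := hB k p
    field_simp
    rfl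
  have hdetA : ev A'.det x t = (evHom x t Bt) ^ n * (Matrix.of J).det := by
    rw [← evHom_apply, RingHom.map_det, hA, Matrix.det_smul, Fintype.card_fin]
  refine ⟨fun i p => ?_, by rw [hdetA]; exact mul_ne_zero (pow_ne_zero _ hBt) hdet⟩
  have h1 : (evHom x t).mapMatrix A'.adjugate * ((evHom x t Bt) • Matrix.of J) = (ev A'.det x t) • 1 := by
    rw [← hA, ← map_mul, Matrix.adjugate_mul, ← evHom_apply]
    ext i j
    simp [Matrix.one_apply]
    split_ifs <;> simp
  have h2 := congrFun (congrFun h1 i) p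
  rw [Matrix.mul_apply] at h2
  simp only [RingHom.mapMatrix_apply, Matrix.map_apply, Matrix.smul_apply, Matrix.of_apply, smul_eq_mul,
    Matrix.one_apply, mul_ite, mul_one, mul_zero] at h2
  rw [← h2]
  refine Finset.sum_congr rfl fun k _ => ?_
  rw [ev_mul, ← evHom_apply, ← evHom_apply]
  ring

lemma per_neg {n : ℕ} {F g h : (Fin n → ℂ) → ℂ} (hg : ∀ u, AnalyticAt ℂ g u) (hh : ∀ u, AnalyticAt ℂ h u)
    (h0 : ∃ u, h u ≠ 0) (hF : ∀ u, h u ≠ 0 → F u = g u / h u) {p d : Fin n → ℂ}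
    (hp : ∀ᶠ z in 𝓝 p, F (z + d) = F z) {u : Fin n → ℂ} (h1 : h (-u) ≠ 0) (h2 : h (-(u + d)) ≠ 0) :
    F (-(u + d)) = F (-u) := by
  have sh : ∀ {g : (Fin n → ℂ) → ℂ}, (∀ u, AnalyticAt ℂ g u) → ∀ u, AnalyticAt ℂ (fun z => g (z + d)) u :=
    fun hg u => (hg _).fun_comp (analyticAt_id.add analyticAt_const)
  have hne : ∃ u, h u * h (u + d) ≠ 0 := by
    obtain ⟨v, hv⟩ := h0
    exact ent_mul hh (sh hh) ⟨v, hv⟩ ⟨v - d, by simpa using hv⟩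
  have hpr : ∀ u, AnalyticAt ℂ (fun z => h z * h (z + d)) u := fun u => (hh u).fun_mul (sh hh u)
  obtain ⟨z, hz1, hz2⟩ := ((ent_freq hpr hne p).and_eventually hp.eventually_nhds).exists
  have hid := ent_eq (f := fun z => g (z + d) * h z) (g := fun z => g z * h (z + d))
    (fun u => (sh hg u).fun_mul (hh u)) (fun u => (hg u).fun_mul (sh hh u)) (w := z) (by
      filter_upwards [hz2, (hpr z).continuousAt.eventually_ne hz1] with y k1 k2
      have a1 := left_ne_zero_of_mul k2
      have a2 := right_ne_zero_of_mul k2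
      rw [hF _ a1, hF _ a2, div_eq_div_iff a2 a1] at k1
      exact k1)
  have h3 := congrFun hid (-(u + d))
  have e : -(u + d) + d = -u := by abel
  simp only [e] at h3
  rw [hF _ h1, hF _ h2, div_eq_div_iff h2 h1, ← h3]

lemma build_core {n : ℕ} (φ : Fin n → (Fin n → ℂ) → ℂ)
    (hmero : ∀ k, Mero (φ k)) (hindep : AnalyticallyIndep φ) (haat : AdmitsAAT φ)
    (θ : (Fin n → ℂ) → ℂ) (hθm : Mero θ) (hθa : ∀ u, (∀ j, AnalyticAt ℂ (φ j) u) → AnalyticAt ℂ θ u)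
    (V : Polynomial (MvPolynomial (Fin n) ℂ)) (hV0 : V ≠ 0)
    (hV : ∀ u, (∀ j, AnalyticAt ℂ (φ j) u) → ev V (fun j => φ j u) (θ u) = 0)
    (A B : Fin n → Fin n → Polynomial (MvPolynomial (Fin n) ℂ))
    (hBne : ∀ k p, ∃ u, (∀ j, AnalyticAt ℂ (φ j) u) ∧ ev (B k p) (fun j => φ j u) (θ u) ≠ 0)
    (hAB : ∀ k p u, (∀ j, AnalyticAt ℂ (φ j) u) → ev (B k p) (fun j => φ j u) (θ u) ≠ 0 →
      pd (φ k) p u = ev (A k p) (fun j => φ j u) (θ u) / ev (B k p) (fun j => φ j u) (θ u))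
    (k : Fin n) : ∃ c : Core n, c.φ = φ ∧ c.θ = θ ∧ c.f = (fun u => φ k (-u)) ∧ ∃ u, c.H u ≠ 0 := by
  obtain ⟨M, β, hMβ⟩ := build_M A B
  choose g h hg hh hh0 hgh using hmero
  obtain ⟨gt, ht, hgt, hht, hht0, hght⟩ := id hθm
  have hmero : ∀ k, Mero (φ k) := fun k => ⟨g k, h k, hg k, hh k, hh0 k, hgh k⟩
  have hfm : Mero (fun u => φ k (-u)) := (hmero k).comp_neg
  have hneg : ∀ {g : (Fin n → ℂ) → ℂ}, (∀ u, AnalyticAt ℂ g u) → ∀ u, AnalyticAt ℂ (fun z => g (-z)) u :=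
    fun hg u => (hg _).fun_comp (analyticAt_neg_fun u)
  have hevA : ∀ (P : Polynomial (MvPolynomial (Fin n) ℂ)) {u}, (∀ j, AnalyticAt ℂ (φ j) u) →
      AnalyticAt ℂ (fun u => ev P (fun j => φ j u) (θ u)) u := fun P u hu => ev_analyticAt P hu (hθa u hu)
  -- first stage
  have hG1 := good_and (good_base hmero hindep)
    (good_and (good_prod (fun j u => h j u ≠ 0) fun j => ⟨h j, hh j, hh0 j, fun u hu => hu⟩)
      (good_and (P := fun u => ht u ≠ 0) ⟨ht, hht, hht0, fun u hu => hu⟩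
        (good_and (P := fun u => h k (-u) ≠ 0) ⟨fun u => h k (-u), hneg (hh k), (by
          obtain ⟨u, hu⟩ := hh0 k
          exact ⟨-u, by simpa using hu⟩), fun u hu => hu⟩
          (good_prod (fun (kp : Fin n × Fin n) u => ev (B kp.1 kp.2) (fun j => φ j u) (θ u) ≠ 0) fun kp => by
            obtain ⟨u, hu1, hu2⟩ := hBne kp.1 kp.2
            obtain ⟨H, a, b, e⟩ := (ev_mero (B kp.1 kp.2) hmero hθm).good (hevA _ hu1).continuousAt hu2
            exact ⟨H, a, b, fun u hu => (e u hu).2⟩))))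
  obtain ⟨H1, hH1, ⟨w, hw⟩, hP1⟩ := id hG1
  have hH1e := (hH1 w).continuousAt.eventually_ne hw
  have hfA : ∀ u, h k (-u) ≠ 0 → AnalyticAt ℂ (fun u => φ k (-u)) u := by
    intro u hu
    refine ((hneg (hg k) u).div (hneg (hh k) u) hu).congr ?_
    filter_upwards [(hneg (hh k) u).continuousAt.eventually_ne hu] with z hz using (hgh k _ hz).symm
  have hMJ : ∀ u, H1 u ≠ 0 → (∀ i p, ∑ k, ev (M i k) (fun j => φ j u) (θ u) * pd (φ k) p u =
      if i = p then ev β (fun j => φ j u) (θ u) else 0) ∧ ev β (fun j => φ j u) (θ u) ≠ 0 := by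
    intro u hu
    obtain ⟨⟨p1, p1'⟩, p2, p3, p4, p5⟩ := hP1 u hu
    exact hMβ _ _ _ (fun k p => p5 (k, p)) (fun k p => hAB k p u p1 (p5 (k, p))) p1'
  obtain ⟨⟨w1, w1'⟩, w2, w3, w4, w5⟩ := hP1 w hw
  obtain ⟨V', hV'0, hV', ⟨NV, hNV0, hNV⟩, hQ⟩ := minimal_poly φ θ w w1 w1' (hθa w w1) V hV0
    (by filter_upwards [hH1e] with u hu using hV u (hP1 u hu).1.1)
  obtain ⟨Nβ, hNβ0, hNβ⟩ := hQ β (by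
    apply Eventually.frequently
    filter_upwards [hH1e] with u hu using (hMJ u hu).2)
  obtain ⟨W0, hW0, u1, hu1⟩ := aat_neg_alg φ hmero hindep haat k
  obtain ⟨W', hW'0, hW', ⟨NW, hNW0, hNW⟩, _⟩ := minimal_poly φ (fun u => φ k (-u)) w w1 w1' (hfA w w4) W0 hW0
    (by
      filter_upwards [hH1e] with u hu
      obtain ⟨⟨p1, p1'⟩, p2, p3, p4, p5⟩ := hP1 u hu
      exact (ev_mero W0 hmero hfm).eq_zero hu1 u (ev_analyticAt W0 p1 (hfA u p4)).continuousAt)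
  set N := NV * NW * Nβ * V'.leadingCoeff * W'.leadingCoeff with hN
  have hN0 : N ≠ 0 := by
    simp only [hN]
    exact mul_ne_zero (mul_ne_zero (mul_ne_zero (mul_ne_zero hNV0 hNW0) hNβ0)
      (Polynomial.leadingCoeff_ne_zero.2 hV'0)) (Polynomial.leadingCoeff_ne_zero.2 hW'0)
  have hNe : ∀ x, eval x N ≠ 0 → eval x NV ≠ 0 ∧ eval x NW ≠ 0 ∧ eval x Nβ ≠ 0 ∧
      eval x V'.leadingCoeff ≠ 0 ∧ eval x W'.leadingCoeff ≠ 0 := by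
    intro x hx
    simp only [hN, map_mul, mul_ne_zero_iff] at hx
    tauto
  have hG2 : ∃ H : (Fin n → ℂ) → ℂ, (∀ u, AnalyticAt ℂ H u) ∧ (∃ u, H u ≠ 0) ∧
      ∀ u, H u ≠ 0 → eval (fun j => φ j u) N ≠ 0 := by
    have hfr : ∃ᶠ u in 𝓝 w, eval (fun j => φ j u) N ≠ 0 := by
      intro hcon
      exact hN0 (no_rel1 w1 w1' N (hcon.mono fun u hu => not_not.1 hu))
    obtain ⟨z, hz1, hz2⟩ := (hfr.and_eventually hH1e).exists
    obtain ⟨H, a, b, e⟩ := (Mero.mvpoly N hmero).good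
      (analyticAt_mvpoly N φ z (hP1 z hz2).1.1).continuousAt hz1
    exact ⟨H, a, b, fun u hu => (e u hu).2⟩
  obtain ⟨H, hH, hH0, hPH⟩ := good_and (P := fun u => H1 u ≠ 0) ⟨H1, hH1, ⟨w, hw⟩, fun u hu => hu⟩ hG2
  refine ⟨{ φ := φ, θ := θ, f := fun u => φ k (-u), H := H, V := V', W := W', β := β, M := M, N := N
            H_an := hH
            gφ := fun j => ⟨g j, h j, hg j, hh j, fun u hu =>
              ⟨(hP1 u (hPH u hu).1).2.1 j, hgh j u ((hP1 u (hPH u hu).1).2.1 j)⟩⟩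
            gθ := ⟨gt, ht, hgt, hht, fun u hu =>
              ⟨(hP1 u (hPH u hu).1).2.2.1, hght u (hP1 u (hPH u hu).1).2.2.1⟩⟩
            gf := ⟨fun u => g k (-u), fun u => h k (-u), hneg (hg k), hneg (hh k), fun u hu =>
              ⟨(hP1 u (hPH u hu).1).2.2.2.1, hgh k _ (hP1 u (hPH u hu).1).2.2.2.1⟩⟩
            Vlc := fun x hx => (hNe x hx).2.2.2.1
            Wlc := fun x hx => (hNe x hx).2.2.2.2
            Vsep := fun x hx t ht => hNV x t (hNe x hx).1 ht
            Wsep := fun x hx t ht => hNW x t (hNe x hx).2.1 ht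
            hβ := fun x hx t ht => hNβ x t (hNe x hx).2.2.1 ht
            hV := fun u hu => (ev_mero V' hmero hθm).eq_zero hV' u
              (hevA V' (hP1 u (hPH u hu).1).1.1).continuousAt
            hW := fun u hu => (ev_mero W' hmero hfm).eq_zero hW' u
              (ev_analyticAt W' (hP1 u (hPH u hu).1).1.1 (hfA u (hP1 u (hPH u hu).1).2.2.2.1)).continuousAt
            hN := fun u hu => (hPH u hu).2
            hM := fun u hu => (hMJ u (hPH u hu).1).1
            hdet := fun u hu => (hP1 u (hPH u hu).1).1.2
            hper := fun p d _ hz u hu hud => per_neg (hg k) (hh k) (hh0 k) (hgh k)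
              (hz.mono fun z hz => hz k) (hP1 u (hPH u hu).1).2.2.2.1
              (hP1 _ (hPH _ hud).1).2.2.2.1 }, rfl, rfl, rfl, hH0⟩

theorem aat_main_aux {n : ℕ} (hn : 1 ≤ n) (φ : Fin n → (Fin n → ℂ) → ℂ)
    (hmero : ∀ k, Mero (φ k)) (hindep : AnalyticallyIndep φ) (haat : AdmitsAAT φ)
    (θ : (Fin n → ℂ) → ℂ) (α : Fin n → Fin n → ℂ)
    (hθ : ∀ u, θ u = ∑ k : Fin n, ∑ p : Fin n, α k p * pd (φ k) p u)
    (V : MvPolynomial (Option (Fin n)) ℂ) (hV0 : V ≠ 0)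
    (hV : ∀ u, (∀ j, AnalyticAt ℂ (φ j) u) → (∀ j p, AnalyticAt ℂ (pd (φ j) p) u) →
      eval (tval θ φ u) V = 0)
    (A B : Fin n → Fin n → MvPolynomial (Option (Fin n)) ℂ)
    (hBne : ∀ k p, ∃ u, (∀ j, AnalyticAt ℂ (φ j) u) ∧ (∀ j q, AnalyticAt ℂ (pd (φ j) q) u) ∧
      eval (tval θ φ u) (B k p) ≠ 0)
    (hAB : ∀ k p u, (∀ j, AnalyticAt ℂ (φ j) u) → (∀ j q, AnalyticAt ℂ (pd (φ j) q) u) →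
      eval (tval θ φ u) (B k p) ≠ 0 →
      pd (φ k) p u = eval (tval θ φ u) (A k p) / eval (tval θ φ u) (B k p))
    (k : Fin n) :
    ∃ C D : MvPolynomial (Option (Fin n)) ℂ,
      (∃ u : Fin n → ℂ, (∀ j, AnalyticAt ℂ (φ j) u) ∧
        (∀ j q, AnalyticAt ℂ (pd (φ j) q) u) ∧ AnalyticAt ℂ (φ k) (-u) ∧
        eval (tval θ φ u) D ≠ 0) ∧
      ∀ u : Fin n → ℂ, (∀ j, AnalyticAt ℂ (φ j) u) →
        (∀ j q, AnalyticAt ℂ (pd (φ j) q) u) → AnalyticAt ℂ (φ k) (-u) →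
        eval (tval θ φ u) D ≠ 0 →
        φ k (-u) = eval (tval θ φ u) C / eval (tval θ φ u) D := by
  have hθf : θ = fun u => ∑ k : Fin n, ∑ p : Fin n, α k p * pd (φ k) p u := funext hθ
  have hθm : Mero θ := by
    rw [hθf]
    exact Mero.sum _ fun k _ => Mero.sum _ fun p _ => (Mero.const _).mul ((hmero k).pd p)
  have hθa : ∀ u, (∀ j, AnalyticAt ℂ (φ j) u) → AnalyticAt ℂ θ u := by
    intro u hu
    rw [hθf]
    exact Finset.analyticAt_fun_sum _ fun k _ => Finset.analyticAt_fun_sum _ fun p _ =>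
      analyticAt_const.fun_mul (pd_analyticAt (hu k) p)
  have htv : ∀ (P : MvPolynomial (Option (Fin n)) ℂ) u,
      ev (optionEquivLeft ℂ (Fin n) P) (fun j => φ j u) (θ u) = eval (tval θ φ u) P := fun P u =>
    ev_option P _ _
  obtain ⟨c, hφ', hθ', hf', u0, hu0⟩ := build_core φ hmero hindep haat θ hθm hθa
    (optionEquivLeft ℂ (Fin n) V) (by simpa using hV0)
    (fun u hu => by rw [htv]; exact hV u hu fun j p => pd_analyticAt (hu j) p)
    (fun k p => optionEquivLeft ℂ (Fin n) (A k p)) (fun k p => optionEquivLeft ℂ (Fin n) (B k p))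
    (fun k p => by
      obtain ⟨u, a, _, b⟩ := hBne k p
      exact ⟨u, a, by rw [htv]; exact b⟩)
    (fun k p u hu hB => by
      rw [htv] at hB
      rw [htv, htv]
      exact hAB k p u hu (fun j q => pd_analyticAt (hu j) q) hB) k
  obtain ⟨C, D, hD, hCD⟩ := c.main hu0
  have gφ := fun j => (c.gφ j).analyticAt c.H_an hu0
  have gf := c.gf.analyticAt c.H_an hu0
  rw [hφ'] at hD hCD gφ
  rw [hf'] at hCD gf
  rw [hθ'] at hD hCD
  have htv' : ∀ (P : Polynomial (MvPolynomial (Fin n) ℂ)) u,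
      eval (tval θ φ u) ((optionEquivLeft ℂ (Fin n)).symm P) = ev P (fun j => φ j u) (θ u) := fun P u =>
    (ev_option' P _ _).symm
  refine ⟨(optionEquivLeft ℂ (Fin n)).symm C, (optionEquivLeft ℂ (Fin n)).symm D, ⟨u0, gφ,
    fun j q => pd_analyticAt (gφ j) q, ?_, by rw [htv']; exact hD⟩, ?_⟩
  · have h1 := AnalyticAt.fun_comp (g := fun u => φ k (-u)) (f := fun z : Fin n → ℂ => -z) (x := -u0)
      (by simpa using gf) (analyticAt_neg_fun _)
    simpa using h1
  · intro u hu _ hk hD'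
    rw [htv'] at hD' ⊢
    rw [htv', eq_div_iff hD', ← sub_eq_zero]
    have hfm : Mero (fun u => φ k (-u)) := (hmero k).comp_neg
    have hm : Mero (fun u => φ k (-u) * ev D (fun j => φ j u) (θ u) + (-1) * ev C (fun j => φ j u) (θ u)) :=
      (hfm.mul (ev_mero D hmero hθm)).add ((Mero.const _).mul (ev_mero C hmero hθm))
    have hka : AnalyticAt ℂ (fun u => φ k (-u)) u := hk.fun_comp (analyticAt_neg_fun u)
    have := hm.eq_zero (w := u0) (by
      filter_upwards [hCD] with z hz
      rw [hz]; ring) u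
      (((hka.fun_mul (ev_analyticAt D hu (hθa u hu))).fun_add
        (analyticAt_const.fun_mul (ev_analyticAt C hu (hθa u hu)))).continuousAt)
    rw [← this]; ring

end AuxDevelopment

theorem aat_inversion_rational_in_theta {n : ℕ} (hn : 1 ≤ n) (φ : Fin n → (Fin n → ℂ) → ℂ)
    (hmero : ∀ k, Mero (φ k)) (hindep : AnalyticallyIndep φ) (haat : AdmitsAAT φ)
    (θ : (Fin n → ℂ) → ℂ) (α : Fin n → Fin n → ℂ)
    (hθ : ∀ u, θ u = ∑ k : Fin n, ∑ p : Fin n, α k p * pd (φ k) p u)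
    (V : MvPolynomial (Option (Fin n)) ℂ) (hV0 : V ≠ 0)
    (hV : ∀ u, (∀ j, AnalyticAt ℂ (φ j) u) → (∀ j p, AnalyticAt ℂ (pd (φ j) p) u) →
      eval (tval θ φ u) V = 0)
    (A B : Fin n → Fin n → MvPolynomial (Option (Fin n)) ℂ)
    (hBne : ∀ k p, ∃ u, (∀ j, AnalyticAt ℂ (φ j) u) ∧ (∀ j q, AnalyticAt ℂ (pd (φ j) q) u) ∧
      eval (tval θ φ u) (B k p) ≠ 0)
    (hAB : ∀ k p u, (∀ j, AnalyticAt ℂ (φ j) u) → (∀ j q, AnalyticAt ℂ (pd (φ j) q) u) →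
      eval (tval θ φ u) (B k p) ≠ 0 →
      pd (φ k) p u = eval (tval θ φ u) (A k p) / eval (tval θ φ u) (B k p))
    (k : Fin n) :
    ∃ C D : MvPolynomial (Option (Fin n)) ℂ,
      (∃ u : Fin n → ℂ, (∀ j, AnalyticAt ℂ (φ j) u) ∧
        (∀ j q, AnalyticAt ℂ (pd (φ j) q) u) ∧ AnalyticAt ℂ (φ k) (-u) ∧
        eval (tval θ φ u) D ≠ 0) ∧
      ∀ u : Fin n → ℂ, (∀ j, AnalyticAt ℂ (φ j) u) →
        (∀ j q, AnalyticAt ℂ (pd (φ j) q) u) → AnalyticAt ℂ (φ k) (-u) →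
        eval (tval θ φ u) D ≠ 0 →
        φ k (-u) = eval (tval θ φ u) C / eval (tval θ φ u) D := aat_main_aux hn φ hmero hindep haat θ α hθ V hV0 hV A B hBne hAB k
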